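/- Let (X,d) be a metric space with integer-valued totally split-decomposable metric satisfying the local rank condition, and let S be the set of all d-splits of X. Then the following are equivalent: (i) S contains no octahedral split subsystem S̄ with the property that for every split S = {A,B} in S∖S̄ there is a split S' = {A',B'} in S̄ such that S and S' are compatible; (ii) for every f in E(X,d), the cell [f] := {g ∈ Δ(X,d) : A(f) ⊆ A(g)} is a parallelotope in ℝ^X, i.e. a translate of {∑_{i=1}^n t_i v_i : t_i ∈ [0,1]} for some finite linearly independent family v_1,…,v_n in ℝ^X. -/

import Mathlib

open Set Function

noncomputable section

variable {X : Type*}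

/-- `d` is a pseudometric on `X`. -/
def IsPseudometric (d : X → X → ℝ) : Prop :=
  (∀ x, d x x = 0) ∧ (∀ x y, d x y = d y x) ∧ ∀ x y z, d x z ≤ d x y + d y z

/-- `d` is a metric on `X`. -/
def IsMetric (d : X → X → ℝ) : Prop :=
  IsPseudometric d ∧ ∀ x y, d x y = 0 → x = y

/-- `d` is integer-valued. -/
def IsIntegerValued (d : X → X → ℝ) : Prop := ∀ x y, ∃ n : ℤ, d x y = (n : ℝ)

/-- The quantity `β^d` associated to the four points `a, a', b, b'`. -/
def betaIdx (d : X → X → ℝ) (a a' b b' : X) : ℝ :=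
  (max (max (d a b + d a' b') (d a' b + d a b')) (d a a' + d b b') - d a a' - d b b') / 2

/-- The isolation index `α^d_{{A,B}}` of the pair `{A,B}`. -/
def isolIdx (d : X → X → ℝ) (A B : Set X) : ℝ :=
  sInf {r : ℝ | ∃ a ∈ A, ∃ a' ∈ A, ∃ b ∈ B, ∃ b' ∈ B, r = betaIdx d a a' b b'}

/-- `{A, B}` is a partial split of `X`. -/
def IsPartialSplit (A B : Set X) : Prop := A.Nonempty ∧ B.Nonempty ∧ Disjoint A B

/-- `{A, B}` is a split of `X`. -/
def IsSplit (A B : Set X) : Prop := IsPartialSplit A B ∧ A ∪ B = univ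

/-- `{A, B}` is a `d`-split of `X`. -/
def IsDSplit (d : X → X → ℝ) (A B : Set X) : Prop := IsSplit A B ∧ 0 < isolIdx d A B

open Classical in
/-- The split pseudometric `δ_S` of the split `{A, Aᶜ}`. -/
def splitDist (A : Set X) (x y : X) : ℝ := if x ∈ A ↔ y ∈ A then 0 else 1

/-- `Δ(X, ρ)`: functions with `f x + f y ≥ ρ x y` for all `x, y`. -/
def DeltaSet (ρ : X → X → ℝ) : Set (X → ℝ) := {f | ∀ x y, ρ x y ≤ f x + f y}

/-- Isbell's injective hull `E(X, d)`: the extremal functions, i.e. those with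
`f x = sup_y (d x y - f y)` for every `x`. -/
def ExtSet (d : X → X → ℝ) : Set (X → ℝ) :=
  {f | ∀ x, IsLUB {r : ℝ | ∃ y, r = d x y - f y} (f x)}

/-- `E'(X, d)`: elements of `Δ(X, d)` such that every point lies in some pair of `A(f)`. -/
def ExtSet' (d : X → X → ℝ) : Set (X → ℝ) :=
  {f | f ∈ DeltaSet d ∧ ∀ x, ∃ y, f x + f y = d x y}

/-- The set `A(f)` of (ordered) pairs where equality holds. -/
def eqSet (d : X → X → ℝ) (f : X → ℝ) : Set (X × X) := {p | f p.1 + f p.2 = d p.1 p.2}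

/-- The direction space of the affine subspace `H(A)`; its dimension is `rank A`. -/
def dirSubmodule (A : Set (X × X)) : Submodule ℝ (X → ℝ) where
  carrier := {h | ∀ p ∈ A, h p.1 + h p.2 = 0}
  add_mem' := by
    intro a b ha hb p hp
    have h1 := ha p hp
    have h2 := hb p hp
    simp only [Pi.add_apply]
    linarith
  zero_mem' := by intro p _; simp
  smul_mem' := by
    intro c a ha p hp
    have h1 := ha p hp
    simp only [Pi.smul_apply, smul_eq_mul]
    linear_combination c * h1

/-- The local rank condition. -/
def LRC (d : X → X → ℝ) : Prop :=
  ∀ f ∈ ExtSet d, ∃ ε : ℝ, 0 < ε ∧ ∃ N : ℕ,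
    ∀ g ∈ ExtSet' d, (∀ x, |f x - g x| < ε) →
      Module.rank ℝ (dirSubmodule (eqSet d g)) ≤ (N : Cardinal)

/-- `d` is totally split-decomposable: `d = ∑_{S a d-split} α_S δ_S`, where each
separating `d`-split `{A, Aᶜ}` is counted once via its part `A` containing `x`. -/
def TSD (d : X → X → ℝ) : Prop :=
  ∀ x y, d x y = ∑ᶠ A ∈ {A : Set X | IsDSplit d A Aᶜ ∧ x ∈ A ∧ y ∉ A}, isolIdx d A Aᶜ

/-- The cell `[f]` of `f ∈ E(X,d)`: all `g ∈ Δ(X,d)` with `A(f) ⊆ A(g)`. -/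
def cellOf (d : X → X → ℝ) (f : X → ℝ) : Set (X → ℝ) :=
  {g | g ∈ DeltaSet d ∧ ∀ x y, f x + f y = d x y → g x + g y = d x y}

/-- `Y` is a partition of `X` into six nonempty pieces `Y i b` (`i : Fin 3`, `b : Bool`). -/
def OctPartition (Y : Fin 3 → Bool → Set X) : Prop :=
  (∀ i b, (Y i b).Nonempty) ∧
  (∀ (i : Fin 3) (b : Bool) (j : Fin 3) (c : Bool),
    (i, b) ≠ (j, c) → Disjoint (Y i b) (Y j c)) ∧
  (⋃ (i) (b), Y i b) = univ

/-- The part `Y¹₁ ∪ Y^b₂ ∪ Y^c₃` of one of the four octahedral splits attached to the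
partition `Y`. -/
def octPart (Y : Fin 3 → Bool → Set X) (b c : Bool) : Set X := Y 0 true ∪ Y 1 b ∪ Y 2 c

/-- Compatibility of the splits `{A, Aᶜ}` and `{A', A'ᶜ}`. -/
def CompatSplits (A A' : Set X) : Prop := A ⊆ A' ∨ A' ⊆ A ∨ A ⊆ A'ᶜ ∨ A'ᶜ ⊆ A

/-- `C ⊆ ℝ^X` is a parallelotope: a translate of `{∑ i, t i • v i : t i ∈ [0,1]}` for a
finite linearly independent family `v`. -/
def IsParallelotope (C : Set (X → ℝ)) : Prop :=
  ∃ (n : ℕ) (v : Fin n → (X → ℝ)) (g₀ : X → ℝ), LinearIndependent ℝ v ∧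
    C = {g | ∃ t : Fin n → ℝ, (∀ i, t i ∈ Icc (0 : ℝ) 1) ∧ g = g₀ + ∑ i, t i • v i}

lemma IsDSplit.pos_of_mem {d : X → X → ℝ} {A B : Set X} (h : IsDSplit d A B) {a a' b b' : X}
    (ha : a ∈ A) (ha' : a' ∈ A) (hb : b ∈ B) (hb' : b' ∈ B) : 0 < betaIdx d a a' b b' := by
  refine h.2.trans_le (csInf_le ⟨0, ?_⟩ ⟨a, ha, a', ha', b, hb, b', hb', rfl⟩)
  rintro r ⟨a, -, a', -, b, -, b', -, rfl⟩
  have := le_max_right (max (d a b + d a' b') (d a' b + d a b')) (d a a' + d b b')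
  unfold betaIdx
  linarith

lemma isolIdx_comm {d : X → X → ℝ} (hsymm : ∀ x y, d x y = d y x) (A B : Set X) :
    isolIdx d A B = isolIdx d B A := by
  have key : ∀ a a' b b', betaIdx d a a' b b' = betaIdx d b b' a a' := by
    intro a a' b b'
    unfold betaIdx
    rw [hsymm b a, hsymm b' a', hsymm b' a, hsymm b a', add_comm (d a' b) (d a b'),
      add_comm (d b b') (d a a')]
    ring
  unfold isolIdx
  congr 1
  ext r
  constructor
  · rintro ⟨a, ha, a', ha', b, hb, b', hb', rfl⟩
    exact ⟨b, hb, b', hb', a, ha, a', ha', key _ _ _ _⟩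
  · rintro ⟨a, ha, a', ha', b, hb, b', hb', rfl⟩
    exact ⟨b, hb, b', hb', a, ha, a', ha', key _ _ _ _⟩

lemma IsDSplit.symm {d : X → X → ℝ} (hsymm : ∀ x y, d x y = d y x) {A B : Set X}
    (h : IsDSplit d A B) : IsDSplit d B A := by
  obtain ⟨⟨⟨h1, h2, h3⟩, h4⟩, h5⟩ := h
  exact ⟨⟨⟨h2, h1, h3.symm⟩, by rwa [union_comm]⟩, by rwa [isolIdx_comm hsymm]⟩

lemma IsDSplit.compl {d : X → X → ℝ} (hsymm : ∀ x y, d x y = d y x) {A : Set X}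
    (h : IsDSplit d A Aᶜ) : IsDSplit d Aᶜ Aᶜᶜ := by
  rw [compl_compl]
  exact h.symm hsymm

/-- Three splits `{A, Aᶜ}`, `{B, Bᶜ}`, `{C, Cᶜ}` are weakly compatible. -/
def WeaklyCompatible (A B C : Set X) : Prop :=
  ∀ x₀ x₁ x₂ x₃ : X,
    (x₀ ∈ A ↔ x₁ ∈ A) → ¬ (x₀ ∈ A ↔ x₂ ∈ A) → ¬ (x₀ ∈ A ↔ x₃ ∈ A) →
    ¬ (x₀ ∈ B ↔ x₁ ∈ B) → (x₀ ∈ B ↔ x₂ ∈ B) → ¬ (x₀ ∈ B ↔ x₃ ∈ B) →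
    ¬ (x₀ ∈ C ↔ x₁ ∈ C) → ¬ (x₀ ∈ C ↔ x₂ ∈ C) → (x₀ ∈ C ↔ x₃ ∈ C) → False

lemma IsDSplit.add_lt_max {d : X → X → ℝ} (hsymm : ∀ x y, d x y = d y x) {A : Set X}
    (h : IsDSplit d A Aᶜ) {x y z w : X} (hxy : x ∈ A ↔ y ∈ A) (hxz : ¬ (x ∈ A ↔ z ∈ A))
    (hxw : ¬ (x ∈ A ↔ w ∈ A)) :
    d x y + d z w < max (d x z + d y w) (d y z + d x w) := by
  wlog hx : x ∈ A generalizing A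
  · exact this (h.compl hsymm) (by simpa using not_congr hxy) (by simpa [not_iff_not] using hxz)
      (by simpa [not_iff_not] using hxw) hx
  have h0 := h.pos_of_mem hx (hxy.1 hx) (show z ∈ Aᶜ by simp_all) (show w ∈ Aᶜ by simp_all)
  unfold betaIdx at h0
  by_contra! hle
  rw [max_eq_right hle] at h0
  linarith

lemma IsDSplit.weaklyCompatible {d : X → X → ℝ} (hsymm : ∀ x y, d x y = d y x) {A B C : Set X}
    (hA : IsDSplit d A Aᶜ) (hB : IsDSplit d B Bᶜ) (hC : IsDSplit d C Cᶜ) :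
    WeaklyCompatible A B C := by
  intro x₀ x₁ x₂ x₃ a1 a2 a3 b1 b2 b3 c1 c2 c3
  have h1 := hA.add_lt_max hsymm a1 a2 a3
  have h2 := hB.add_lt_max hsymm b2 b1 b3
  have h3 := hC.add_lt_max hsymm c3 c1 c2
  have e1 := hsymm x₂ x₁
  have e2 := hsymm x₃ x₁
  have e3 := hsymm x₃ x₂
  rw [lt_max_iff] at h1 h2 h3
  rcases h1 with h1 | h1 <;> rcases h2 with h2 | h2 <;> rcases h3 with h3 | h3 <;> linarith

lemma mem_deltaSet_of_mem_extSet {d : X → X → ℝ} {f : X → ℝ} (hf : f ∈ ExtSet d) :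
    f ∈ DeltaSet d := by
  intro x y
  have := (hf x).1 ⟨y, rfl⟩
  linarith

lemma mem_extSet_of_mem_extSet' {d : X → X → ℝ} {f : X → ℝ} (hf : f ∈ ExtSet' d) :
    f ∈ ExtSet d := by
  intro x
  refine IsGreatest.isLUB ⟨?_, ?_⟩
  · obtain ⟨y, hy⟩ := hf.2 x
    exact ⟨y, by linarith⟩
  · rintro r ⟨y, rfl⟩
    have := hf.1 x y
    linarith

/-- Below a function of `Δ(X, d)` with values in `(1/k)ℤ` there is one in `E'(X, d)`. -/
lemma exists_mem_extSet'_le {d : X → X → ℝ} (h0 : ∀ x, d x x = 0) (hsymm : ∀ x y, d x y = d y x)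
    (hint : IsIntegerValued d) {k : ℕ} (hk : 0 < k) {F : X → ℤ}
    (hF : ∀ x y, (k : ℝ) * d x y ≤ F x + F y) :
    ∃ G : X → ℤ, G ≤ F ∧ (fun x => (G x : ℝ) / k) ∈ ExtSet' d := by
  classical
  choose dn hdn using hint
  have hk' : (0 : ℝ) < k := by exact_mod_cast hk
  let s : Set (X → ℤ)ᵒᵈ := {G | ∀ x y, (k : ℤ) * dn x y ≤ OrderDual.ofDual G x + OrderDual.ofDual G y}
  have hdn0 : ∀ x, dn x x = 0 := fun x => by
    have := h0 x
    rw [hdn] at this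
    exact_mod_cast this
  have hdns : ∀ x y, dn x y = dn y x := fun x y => by
    have := hsymm x y
    rw [hdn, hdn] at this
    exact_mod_cast this
  have hnn : ∀ G : X → ℤ, OrderDual.toDual G ∈ s → ∀ x, 0 ≤ G x := by
    intro G hG x
    have := hG x x
    rw [hdn0] at this
    simp only [OrderDual.ofDual_toDual] at this
    lia
  obtain ⟨m, hm1, hm2⟩ := zorn_le_nonempty₀ s (by
    intro c hc hchain y hy
    let S : X → Set ℤ := fun x => Set.image (fun G : (X → ℤ)ᵒᵈ => OrderDual.ofDual G x) c
    have hbdd : ∀ x, BddBelow (S x) := fun x => ⟨0, by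
      rintro _ ⟨G, hG, rfl⟩
      exact hnn _ (hc hG) x⟩
    have hne : ∀ x, (S x).Nonempty := fun x => ⟨_, y, hy, rfl⟩
    refine ⟨OrderDual.toDual (fun x => sInf (S x)), ?_, ?_⟩
    · intro x y
      obtain ⟨G1, hG1, e1⟩ := Int.csInf_mem (hne x) (hbdd x)
      obtain ⟨G2, hG2, e2⟩ := Int.csInf_mem (hne y) (hbdd y)
      simp only [OrderDual.ofDual_toDual]
      rw [← e1, ← e2]
      rcases hchain.total hG1 hG2 with h | h
      · have h1 := hc hG2 x y
        have h2 : OrderDual.ofDual G2 x ≤ OrderDual.ofDual G1 x := (OrderDual.ofDual_le_ofDual.2 h) x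
        simp only
        lia
      · have h1 := hc hG1 x y
        have h2 : OrderDual.ofDual G1 y ≤ OrderDual.ofDual G2 y := (OrderDual.ofDual_le_ofDual.2 h) y
        simp only
        lia
    · intro z hz
      rw [← OrderDual.ofDual_le_ofDual]
      intro x
      exact csInf_le (hbdd x) ⟨z, hz, rfl⟩) (OrderDual.toDual F) (by
    intro x y
    have := hF x y
    rw [hdn] at this
    exact_mod_cast this)
  set G : X → ℤ := OrderDual.ofDual m with hGdef
  have hGs : ∀ x y, (k : ℤ) * dn x y ≤ G x + G y := hm2.1
  refine ⟨G, OrderDual.ofDual_le_ofDual.2 hm1, ?_, ?_⟩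
  · intro x y
    have h1 : ((k : ℤ) * dn x y : ℝ) ≤ G x + G y := by exact_mod_cast hGs x y
    rw [hdn, ← add_div, le_div_iff₀ hk']
    push_cast at h1
    linarith
  · intro x
    by_contra! hne
    have hlt : ∀ y, (k : ℤ) * dn x y < G x + G y := by
      intro y
      refine lt_of_le_of_ne (hGs x y) fun he => hne y ?_
      have : ((k : ℤ) * dn x y : ℝ) = G x + G y := by exact_mod_cast he
      rw [hdn, ← add_div, div_eq_iff hk'.ne']
      push_cast at this
      linarith
    have hmem : OrderDual.toDual (Function.update G x (G x - 1)) ∈ s := by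
      intro y z
      simp only [OrderDual.ofDual_toDual]
      by_cases hy : y = x <;> by_cases hz : z = x
      · subst hy; subst hz
        have := hlt z
        simp only [Function.update_self, hdn0, mul_zero] at *
        lia
      · subst hy
        have := hlt z
        simp only [Function.update_self, Function.update_of_ne hz]
        lia
      · subst hz
        have := hlt y
        rw [hdns] at this
        simp only [Function.update_self, Function.update_of_ne hy]
        lia
      · simp only [Function.update_of_ne hy, Function.update_of_ne hz]
        exact hGs y z
    have hle : m ≤ OrderDual.toDual (Function.update G x (G x - 1)) := by
      rw [← OrderDual.ofDual_le_ofDual]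
      intro y
      by_cases hy : y = x
      · subst hy
        simp [hGdef]
      · simp [hy, hGdef]
    have h3 := (OrderDual.ofDual_le_ofDual.2 (hm2.2 hmem hle)) x
    simp [hGdef] at h3

lemma exists_mem_extSet'_near {d : X → X → ℝ} (h0 : ∀ x, d x x = 0)
    (hsymm : ∀ x y, d x y = d y x) (hint : IsIntegerValued d) {f : X → ℝ} (hf : f ∈ ExtSet d)
    {k : ℕ} (hk : 0 < k) : ∃ g ∈ ExtSet' d, ∀ x, |f x - g x| ≤ 1 / k := by
  have hk' : (0 : ℝ) < k := by exact_mod_cast hk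
  obtain ⟨G, hG, hE⟩ := exists_mem_extSet'_le h0 hsymm hint hk (F := fun x => ⌈k * f x⌉) (by
    intro x y
    have h1 := Int.le_ceil (k * f x)
    have h2 := Int.le_ceil (k * f y)
    have h3 := mul_le_mul_of_nonneg_left (mem_deltaSet_of_mem_extSet hf x y) hk'.le
    linarith)
  have hup : ∀ x, (G x : ℝ) / k ≤ f x + 1 / k := by
    intro x
    have h1 := Int.ceil_lt_add_one (k * f x)
    have h2 : (G x : ℝ) ≤ ⌈k * f x⌉ := by exact_mod_cast hG x
    rw [div_le_iff₀ hk', add_mul, one_div_mul_cancel hk'.ne']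
    linarith
  refine ⟨_, hE, fun x => abs_le.2 ⟨by have := hup x; linarith, ?_⟩⟩
  have : f x ≤ (G x : ℝ) / k + 1 / k := by
    refine (hf x).2 ?_
    rintro r ⟨y, rfl⟩
    have h1 := hE.1 x y
    have h2 := hup y
    simp only at h1
    linarith
  linarith

/-- The classes modulo `ℤ`, up to sign, of the values of `g` bound the rank of `A(g)` from
below. -/
lemma le_rank_of_not_int {d : X → X → ℝ} (hint : IsIntegerValued d) {g : X → ℝ} {M : ℕ}
    {y : Fin M → X} (hadd : ∀ n m (z : ℤ), g (y n) + g (y m) ≠ z)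
    (hsub : ∀ n m, n ≠ m → ∀ z : ℤ, g (y n) - g (y m) ≠ z) :
    (M : Cardinal) ≤ Module.rank ℝ (dirSubmodule (eqSet d g)) := by
  classical
  let P : Fin M → X → Prop := fun n x => ∃ z : ℤ, g x - g (y n) = z
  let Q : Fin M → X → Prop := fun n x => ∃ z : ℤ, g x + g (y n) = z
  have hPQ : ∀ n x, P n x → ¬ Q n x := by
    rintro n x ⟨z, hz⟩ ⟨w, hw⟩
    exact hadd n n (w - z) (by push_cast; linarith)
  let χ : Fin M → X → ℝ := fun n x => if P n x then 1 else if Q n x then -1 else 0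
  have hχ : ∀ n, χ n ∈ dirSubmodule (eqSet d g) := by
    intro n p hp
    obtain ⟨k, hk⟩ := hint p.1 p.2
    have hp' : g p.1 + g p.2 = k := by rw [← hk]; exact hp
    have e1 : P n p.1 ↔ Q n p.2 := by
      constructor
      · rintro ⟨z, hz⟩; exact ⟨k - z, by push_cast; linarith⟩
      · rintro ⟨z, hz⟩; exact ⟨k - z, by push_cast; linarith⟩
    have e2 : P n p.2 ↔ Q n p.1 := by
      constructor
      · rintro ⟨z, hz⟩; exact ⟨k - z, by push_cast; linarith⟩
      · rintro ⟨z, hz⟩; exact ⟨k - z, by push_cast; linarith⟩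
    have h1 := hPQ n p.1
    simp only [χ]
    rw [e2, e1]
    rw [e1] at h1
    by_cases a : Q n p.1 <;> by_cases b : Q n p.2 <;> simp_all
  have hval : ∀ n m, χ n (y m) = if n = m then 1 else 0 := by
    intro n m
    simp only [χ]
    by_cases h : n = m
    · subst h
      rw [if_pos ⟨0, by simp⟩, if_pos rfl]
    · rw [if_neg, if_neg, if_neg h]
      · rintro ⟨z, hz⟩; exact hadd m n z hz
      · rintro ⟨z, hz⟩; exact hsub m n (Ne.symm h) z hz
  have hli : LinearIndependent ℝ (fun n => (⟨χ n, hχ n⟩ : dirSubmodule (eqSet d g))) := by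
    rw [Fintype.linearIndependent_iff]
    intro c hc i
    have h1 := congrArg (fun v : dirSubmodule (eqSet d g) => (v : X → ℝ) (y i)) hc
    simpa [hval] using h1
  simpa using hli.cardinal_lift_le_rank

lemma eventually_forall_le_abs_sub_int {r : ℝ} (hr : ∀ z : ℤ, r ≠ z) :
    ∀ᶠ c in nhdsWithin (0 : ℝ) (Ioi 0), ∀ z : ℤ, c ≤ |r - z| := by
  have h : 0 < |r - round r| := abs_pos.2 (sub_ne_zero.2 (hr _))
  filter_upwards [Ioo_mem_nhdsGT h] with c hc z
  exact hc.2.le.trans (round_le r z)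

theorem mem_extSet'_of_mem_extSet {d : X → X → ℝ} (h0 : ∀ x, d x x = 0)
    (hsymm : ∀ x y, d x y = d y x) (hint : IsIntegerValued d) (hlrc : LRC d) {f : X → ℝ}
    (hf : f ∈ ExtSet d) : f ∈ ExtSet' d := by
  refine ⟨mem_deltaSet_of_mem_extSet hf, ?_⟩
  by_contra! hx
  obtain ⟨x₀, hx₀⟩ := hx
  obtain ⟨ε, hε, N, hN⟩ := hlrc f hf
  have hpos : ∀ y, 0 < f x₀ + f y - d x₀ y := fun y =>
    sub_pos.2 (lt_of_le_of_ne (mem_deltaSet_of_mem_extSet hf x₀ y) (hx₀ y).symm)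
  have hsmall : ∀ δ > 0, ∃ y, f x₀ + f y - d x₀ y < δ := by
    intro δ hδ
    by_contra! h
    have := (hf x₀).2 (show f x₀ - δ ∈ upperBounds _ by
      rintro r ⟨y, rfl⟩
      have := h y
      linarith)
    linarith
  set δ : ℝ := (⌊-2 * f x₀⌋ + 1 + 2 * f x₀) / 2 with hδdef
  have hδ : 0 < δ := by
    have := Int.lt_floor_add_one (-2 * f x₀)
    rw [hδdef]
    linarith
  have hδ' : δ ≤ 1 / 2 := by
    have := Int.floor_le (-2 * f x₀)
    rw [hδdef]
    linarith
  let V : Set ℝ := {η | η < δ ∧ ∃ y, f x₀ + f y - d x₀ y = η}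
  have hV : V.Infinite := by
    intro hfin
    obtain ⟨y, hy⟩ := hsmall δ hδ
    obtain ⟨m, hm, hmin⟩ := hfin.exists_minimal ⟨_, hy, y, rfl⟩
    obtain ⟨hm1, y', rfl⟩ := hm
    obtain ⟨w, hw⟩ := hsmall _ (hpos y')
    have := hmin (y := f x₀ + f w - d x₀ w) ⟨hw.trans hm1, w, rfl⟩ hw.le
    linarith
  let e := hV.natEmbedding
  have he : ∀ n, ∃ y, f x₀ + f y - d x₀ y = e n := fun n => (e n).2.2
  choose y hy using he
  have hlt : ∀ n, f x₀ + f (y n) - d x₀ (y n) < δ := fun n => by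
    rw [hy]
    exact (e n).2.1
  choose dn hdn using hint
  have hadd : ∀ n m (z : ℤ), f (y n) + f (y m) ≠ z := by
    intro n m z hz
    have a1 := hlt n
    have a2 := hlt m
    have a3 := hpos (y n)
    have a4 := hpos (y m)
    rw [hdn] at a1 a2 a3 a4
    have b1 : ((⌊-2 * f x₀⌋ : ℤ) : ℝ) < ((z - dn x₀ (y n) - dn x₀ (y m) : ℤ) : ℝ) := by
      have := Int.floor_le (-2 * f x₀)
      push_cast
      linarith
    have b2 : ((z - dn x₀ (y n) - dn x₀ (y m) : ℤ) : ℝ) < ((⌊-2 * f x₀⌋ + 1 : ℤ) : ℝ) := by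
      push_cast
      linarith
    have b1' : ⌊-2 * f x₀⌋ < z - dn x₀ (y n) - dn x₀ (y m) := by exact_mod_cast b1
    have b2' : z - dn x₀ (y n) - dn x₀ (y m) < ⌊-2 * f x₀⌋ + 1 := by exact_mod_cast b2
    lia
  have hsub : ∀ n m, n ≠ m → ∀ z : ℤ, f (y n) - f (y m) ≠ z := by
    intro n m hnm z hz
    have a1 := hlt n
    have a2 := hlt m
    have a3 := hpos (y n)
    have a4 := hpos (y m)
    have a5 : f x₀ + f (y n) - d x₀ (y n) ≠ f x₀ + f (y m) - d x₀ (y m) := by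
      rw [hy, hy]
      exact fun h => hnm (e.injective (Subtype.ext h))
    rw [hdn, hdn] at a5
    rw [hdn] at a1 a2 a3 a4
    have b1 : ((-1 : ℤ) : ℝ) < ((z - dn x₀ (y n) + dn x₀ (y m) : ℤ) : ℝ) := by
      push_cast
      linarith
    have b2 : ((z - dn x₀ (y n) + dn x₀ (y m) : ℤ) : ℝ) < ((1 : ℤ) : ℝ) := by
      push_cast
      linarith
    have b1' : -1 < z - dn x₀ (y n) + dn x₀ (y m) := by exact_mod_cast b1
    have b2' : z - dn x₀ (y n) + dn x₀ (y m) < 1 := by exact_mod_cast b2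
    have b3 : z - dn x₀ (y n) + dn x₀ (y m) = 0 := by lia
    have b4 : ((z - dn x₀ (y n) + dn x₀ (y m) : ℤ) : ℝ) = 0 := by exact_mod_cast b3
    push_cast at b4
    apply a5
    linarith
  have ev1 : ∀ᶠ c in nhdsWithin (0 : ℝ) (Ioi 0), ∀ n m : Fin (N + 1), ∀ z : ℤ,
      c ≤ |f (y n) + f (y m) - z| :=
    Filter.eventually_all.2 fun n => Filter.eventually_all.2 fun m =>
      eventually_forall_le_abs_sub_int (hadd n m)
  have ev2 : ∀ᶠ c in nhdsWithin (0 : ℝ) (Ioi 0), ∀ n m : Fin (N + 1), n ≠ m → ∀ z : ℤ,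
      c ≤ |f (y n) - f (y m) - z| :=
    Filter.eventually_all.2 fun n => Filter.eventually_all.2 fun m => by
      by_cases h : n = m
      · simp [h]
      · filter_upwards [eventually_forall_le_abs_sub_int
          (hsub n m (fun h' => h (Fin.ext h')))] with c hc _
        exact hc
  obtain ⟨c, hc1, hc2, hc0⟩ := (ev1.and (ev2.and self_mem_nhdsWithin)).exists
  obtain ⟨k, hk⟩ := exists_nat_gt (max (1 / ε) (2 / c))
  have hc0' : (0 : ℝ) < c := hc0
  have hk0 : (0 : ℝ) < k := (lt_of_lt_of_le (by positivity) (le_max_left _ _)).trans hk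
  have hkε : 1 / (k : ℝ) < ε := by
    rw [one_div_lt hk0 hε]
    exact (le_max_left _ _).trans_lt hk
  have hkc : 2 * (1 / (k : ℝ)) < c := by
    have := (le_max_right _ _).trans_lt hk
    rw [div_lt_iff₀ hc0'] at this
    rw [mul_one_div, div_lt_iff₀ hk0]
    linarith
  obtain ⟨g, hg, hgf⟩ := exists_mem_extSet'_near h0 hsymm (fun x y => ⟨_, hdn x y⟩) hf
    (k := k) (by exact_mod_cast hk0)
  have hle := hN g hg (fun x => (hgf x).trans_lt hkε)
  have hge := le_rank_of_not_int (d := d) (fun x y => ⟨_, hdn x y⟩) (g := g) (M := N + 1)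
    (y := fun n => y n) (by
      intro n m z hz
      have h1 := hc1 n m z
      have h2 := abs_le.1 (hgf (y n))
      have h3 := abs_le.1 (hgf (y m))
      have h4 : |f (y n) + f (y m) - z| ≤ 2 * (1 / (k : ℝ)) :=
        abs_le.2 ⟨by linarith, by linarith⟩
      linarith) (by
      intro n m hnm z hz
      have h1 := hc2 n m hnm z
      have h2 := abs_le.1 (hgf (y n))
      have h3 := abs_le.1 (hgf (y m))
      have h4 : |f (y n) - f (y m) - z| ≤ 2 * (1 / (k : ℝ)) :=
        abs_le.2 ⟨by linarith, by linarith⟩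
      linarith)
  have := hge.trans hle
  have : N + 1 ≤ N := by exact_mod_cast this
  lia

lemma splitDist_of_iff {A : Set X} {x y : X} (h : x ∈ A ↔ y ∈ A) : splitDist A x y = 0 := if_pos h

lemma splitDist_of_not_iff {A : Set X} {x y : X} (h : ¬ (x ∈ A ↔ y ∈ A)) : splitDist A x y = 1 :=
  if_neg h

/-- `d` is the sum of positive multiples of split pseudometrics of weakly compatible splits. -/
structure SplitDecomp (d : X → X → ℝ) (ι : Type*) where
  /-- one part of each split -/
  A : ι → Set X
  /-- the weights -/
  wt : ι → ℝ
  wt_pos : ∀ i, 0 < wt i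
  sep_finite : ∀ x y, {i | ¬ (x ∈ A i ↔ y ∈ A i)}.Finite
  dist_eq : ∀ x y, d x y = ∑ᶠ i, wt i * splitDist (A i) x y
  weak : ∀ i j k, WeaklyCompatible (A i) (A j) (A k)

open Classical in
/-- The function with value `t` on `A` and `w - t` off `A`. -/
def splitFun (A : Set X) (w t : ℝ) (x : X) : ℝ := if x ∈ A then t else w - t

lemma splitFun_of_mem {A : Set X} {w t : ℝ} {x : X} (h : x ∈ A) : splitFun A w t x = t := if_pos h

lemma splitFun_of_notMem {A : Set X} {w t : ℝ} {x : X} (h : x ∉ A) : splitFun A w t x = w - t :=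
  if_neg h

lemma splitFun_add_splitFun_of_not_iff {A : Set X} {w t : ℝ} {x y : X}
    (h : ¬ (x ∈ A ↔ y ∈ A)) : splitFun A w t x + splitFun A w t y = w := by
  by_cases hx : x ∈ A <;> by_cases hy : y ∈ A
  · simp_all
  · rw [splitFun_of_mem hx, splitFun_of_notMem hy]; ring
  · rw [splitFun_of_notMem hx, splitFun_of_mem hy]; ring
  · simp_all

lemma splitFun_mem_deltaSet {A : Set X} {w t : ℝ} (ht : t ∈ Icc 0 w) (x y : X) :
    w * splitDist A x y ≤ splitFun A w t x + splitFun A w t y := by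
  obtain ⟨h1, h2⟩ := ht
  by_cases h : x ∈ A ↔ y ∈ A
  · rw [splitDist_of_iff h]
    unfold splitFun
    split_ifs <;> linarith
  · rw [splitDist_of_not_iff h, splitFun_add_splitFun_of_not_iff h, mul_one]

namespace SplitDecomp

variable {d : X → X → ℝ} {ι : Type*} (D : SplitDecomp d ι)

/-- What remains of `d` after removing the splits in `F`. -/
def rest (F : Finset ι) (x y : X) : ℝ := d x y - ∑ i ∈ F, D.wt i * splitDist (D.A i) x y

lemma dist_self (D : SplitDecomp d ι) (x : X) : d x x = 0 := by
  rw [D.dist_eq]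
  simp [splitDist]

lemma rest_self (F : Finset ι) (x : X) : D.rest F x x = 0 := by
  simp [rest, D.dist_self, splitDist]

lemma dist_eq_sum {U : Finset ι} {x y : X} (hU : ∀ i, ¬ (x ∈ D.A i ↔ y ∈ D.A i) → i ∈ U) :
    d x y = ∑ i ∈ U, D.wt i * splitDist (D.A i) x y := by
  rw [D.dist_eq]
  refine finsum_eq_sum_of_support_subset _ fun i hi => ?_
  refine hU i fun h => hi ?_
  simp [splitDist_of_iff h]

open Classical in
lemma rest_eq_sum {U : Finset ι} (F : Finset ι) {x y : X}
    (hU : ∀ i, ¬ (x ∈ D.A i ↔ y ∈ D.A i) → i ∈ U) :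
    D.rest F x y = ∑ i ∈ U \ F, D.wt i * splitDist (D.A i) x y := by
  have h1 := D.dist_eq_sum (U := U ∪ F) (fun i hi => Finset.mem_union_left _ (hU i hi))
  have h2 := Finset.sum_sdiff (f := fun i => D.wt i * splitDist (D.A i) x y)
    (Finset.subset_union_right (s₁ := U) (s₂ := F))
  rw [Finset.union_sdiff_right] at h2
  rw [rest, h1, ← h2]
  ring

open Classical in
lemma rest_insert {i : ι} {F : Finset ι} (hi : i ∉ F) (x y : X) :
    D.rest (insert i F) x y = D.rest F x y - D.wt i * splitDist (D.A i) x y := by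
  rw [rest, rest, Finset.sum_insert hi]
  ring

lemma two_wt_le_sum {W : Finset ι} {i : ι} (hi : i ∈ W) {a a' b b' : X}
    (h1 : a ∈ D.A i ↔ a' ∈ D.A i) (h2 : ¬ (a ∈ D.A i ↔ b ∈ D.A i))
    (h3 : ¬ (a ∈ D.A i ↔ b' ∈ D.A i))
    (hno : ∀ j ∈ W, (a ∈ D.A j ↔ b ∈ D.A j) → (a' ∈ D.A j ↔ b' ∈ D.A j) →
      (a ∈ D.A j ↔ a' ∈ D.A j)) :
    (∑ j ∈ W, D.wt j * splitDist (D.A j) a a') + (∑ j ∈ W, D.wt j * splitDist (D.A j) b b')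
      + 2 * D.wt i ≤
    (∑ j ∈ W, D.wt j * splitDist (D.A j) a b) + ∑ j ∈ W, D.wt j * splitDist (D.A j) a' b' := by
  have hterm : ∀ j ∈ W, 0 ≤ D.wt j * (splitDist (D.A j) a b + splitDist (D.A j) a' b'
      - splitDist (D.A j) a a' - splitDist (D.A j) b b') := by
    intro j hj
    refine mul_nonneg (D.wt_pos j).le ?_
    have := hno j hj
    unfold splitDist
    by_cases p : a ∈ D.A j <;> by_cases q : a' ∈ D.A j <;> by_cases r : b ∈ D.A j <;>
      by_cases s : b' ∈ D.A j <;> simp [p, q, r, s] at this ⊢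
  have h := Finset.single_le_sum hterm hi
  have e : splitDist (D.A i) a b + splitDist (D.A i) a' b'
      - splitDist (D.A i) a a' - splitDist (D.A i) b b' = 2 := by
    rw [splitDist_of_not_iff h2, splitDist_of_iff h1, splitDist_of_not_iff (by tauto),
      splitDist_of_iff (by tauto)]
    norm_num
  rw [e] at h
  simp only [mul_sub, mul_add, Finset.sum_sub_distrib, Finset.sum_add_distrib] at h
  linarith

lemma rest_add_rest_le_max {F : Finset ι} {i : ι} (hi : i ∉ F) {a a' b b' : X}
    (h1 : a ∈ D.A i ↔ a' ∈ D.A i) (h2 : ¬ (a ∈ D.A i ↔ b ∈ D.A i))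
    (h3 : ¬ (a ∈ D.A i ↔ b' ∈ D.A i)) :
    D.rest F a a' + D.rest F b b' + 2 * D.wt i ≤
      max (D.rest F a b + D.rest F a' b') (D.rest F a b' + D.rest F a' b) := by
  classical
  let S : X → X → Finset ι := fun x y => (D.sep_finite x y).toFinset
  have hS : ∀ i x y, ¬ (x ∈ D.A i ↔ y ∈ D.A i) → i ∈ S x y := fun i x y h => by
    rw [Set.Finite.mem_toFinset]
    exact h
  let U : Finset ι := S a a' ∪ S b b' ∪ S a b ∪ S a' b' ∪ S a b' ∪ S a' b
  rw [D.rest_eq_sum (U := U) F (x := a) (y := a') (fun j hj => by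
      simp [U, hS j _ _ hj]),
    D.rest_eq_sum (U := U) F (x := b) (y := b') (fun j hj => by
      simp [U, hS j _ _ hj]),
    D.rest_eq_sum (U := U) F (x := a) (y := b) (fun j hj => by
      simp [U, hS j _ _ hj]),
    D.rest_eq_sum (U := U) F (x := a') (y := b') (fun j hj => by
      simp [U, hS j _ _ hj]),
    D.rest_eq_sum (U := U) F (x := a) (y := b') (fun j hj => by
      simp [U, hS j _ _ hj]),
    D.rest_eq_sum (U := U) F (x := a') (y := b) (fun j hj => by
      simp [U, hS j _ _ hj])]
  have hiW : i ∈ U \ F := by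
    simp [hi, U, hS i _ _ h2]
  by_cases hex : ∃ j ∈ U \ F, (a ∈ D.A j ↔ b ∈ D.A j) ∧ (a' ∈ D.A j ↔ b' ∈ D.A j) ∧
      ¬ (a ∈ D.A j ↔ a' ∈ D.A j)
  · obtain ⟨j, -, hj1, hj2, hj3⟩ := hex
    refine le_max_of_le_right ?_
    have := D.two_wt_le_sum hiW (a := a) (a' := a') (b := b') (b' := b) h1 h3 h2 (by
      intro k _ hk1 hk2
      by_contra hk3
      exact D.weak i j k a a' b b' h1 h2 h3 hj3 hj1 (fun h => hj3 (h.trans hj2.symm))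
        hk3 (fun h => hk3 (h.trans hk2.symm)) hk1)
    have e : ∀ j, splitDist (D.A j) b' b = splitDist (D.A j) b b' := by
      intro j
      simp only [splitDist, iff_comm]
    simpa only [e] using this
  · push Not at hex
    exact le_max_of_le_left (D.two_wt_le_sum hiW h1 h2 h3 hex)

lemma nonneg_of_mem_deltaSet_rest {F : Finset ι} {h : X → ℝ} (hh : h ∈ DeltaSet (D.rest F))
    (x : X) : 0 ≤ h x := by
  have := hh x x
  rw [D.rest_self] at this
  linarith

open Classical in
lemma exists_splitFun_sub {F : Finset ι} {i : ι} (hi : i ∉ F) {h : X → ℝ}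
    (hh : h ∈ DeltaSet (D.rest F)) :
    ∃ t ∈ Icc 0 (D.wt i),
      (fun x => h x - splitFun (D.A i) (D.wt i) t x) ∈ DeltaSet (D.rest (insert i F)) := by
  have hw := D.wt_pos i
  let L : Set ℝ := {l | l = 0 ∨ ∃ b ∉ D.A i, ∃ b' ∉ D.A i,
    l = D.wt i - (h b + h b' - D.rest F b b') / 2}
  have hLw : ∀ l ∈ L, l ≤ D.wt i := by
    rintro l (rfl | ⟨b, hb, b', hb', rfl⟩)
    · exact hw.le
    · have := hh b b'
      linarith
  have hbdd : BddAbove L := ⟨_, hLw⟩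
  have hne : L.Nonempty := ⟨0, Or.inl rfl⟩
  have ht0 : 0 ≤ sSup L := le_csSup hbdd (Or.inl rfl)
  have htw : sSup L ≤ D.wt i := csSup_le hne hLw
  have htA : ∀ a ∈ D.A i, ∀ a' ∈ D.A i, sSup L ≤ (h a + h a' - D.rest F a a') / 2 := by
    intro a ha a' ha'
    refine csSup_le hne ?_
    rintro l (rfl | ⟨b, hb, b', hb', rfl⟩)
    · have := hh a a'
      linarith
    · have h1 := D.rest_add_rest_le_max hi (a := a) (a' := a') (b := b) (b' := b')
        (by tauto) (by tauto) (by tauto)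
      have h2 := hh a b
      have h3 := hh a' b'
      have h4 := hh a b'
      have h5 := hh a' b
      rcases le_max_iff.1 h1 with h1 | h1 <;> linarith
  have htB : ∀ b ∉ D.A i, ∀ b' ∉ D.A i,
      D.wt i - (h b + h b' - D.rest F b b') / 2 ≤ sSup L := fun b hb b' hb' =>
    le_csSup hbdd (Or.inr ⟨b, hb, b', hb', rfl⟩)
  refine ⟨sSup L, ⟨ht0, htw⟩, fun x y => ?_⟩
  rw [D.rest_insert hi]
  beta_reduce
  have hxy := hh x y
  by_cases hx : x ∈ D.A i <;> by_cases hy : y ∈ D.A i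
  · rw [splitDist_of_iff (by tauto), splitFun_of_mem hx, splitFun_of_mem hy]
    have := htA x hx y hy
    linarith
  · have e := splitFun_add_splitFun_of_not_iff (A := D.A i) (w := D.wt i) (t := sSup L)
      (x := x) (y := y) (by tauto)
    rw [splitDist_of_not_iff (by tauto)]
    linarith
  · have e := splitFun_add_splitFun_of_not_iff (A := D.A i) (w := D.wt i) (t := sSup L)
      (x := x) (y := y) (by tauto)
    rw [splitDist_of_not_iff (by tauto)]
    linarith
  · rw [splitDist_of_iff (by tauto), splitFun_of_notMem hx, splitFun_of_notMem hy]
    have := htB x hx y hy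
    linarith

open Classical in
/-- A function of `Δ` splits along any finite set of splits. -/
lemma exists_sum_splitFun_sub {F : Finset ι} (G : Finset ι) (hFG : Disjoint F G) {h : X → ℝ}
    (hh : h ∈ DeltaSet (D.rest F)) :
    ∃ t : ι → ℝ, (∀ i, t i ∈ Icc 0 (D.wt i)) ∧
      (fun x => h x - ∑ i ∈ G, splitFun (D.A i) (D.wt i) (t i) x) ∈ DeltaSet (D.rest (F ∪ G)) := by
  induction G using Finset.induction_on with
  | empty => exact ⟨0, fun i => ⟨le_rfl, (D.wt_pos i).le⟩, by simpa using hh⟩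
  | insert i G hiG ih =>
    rw [Finset.disjoint_insert_right] at hFG
    obtain ⟨t, ht, hG⟩ := ih hFG.2
    obtain ⟨s, hs, hi⟩ := D.exists_splitFun_sub (i := i) (by simp [hFG.1, hiG]) hG
    refine ⟨Function.update t i s, fun j => ?_, ?_⟩
    · by_cases hj : j = i
      · subst hj
        simpa using hs
      · simpa [hj] using ht j
    · rw [Finset.union_insert]
      convert hi using 1
      funext x
      rw [Finset.sum_insert hiG, Function.update_self, Finset.sum_congr rfl (fun j hj => by
        rw [Function.update_of_ne (fun e : j = i => hiG (e ▸ hj))])]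
      ring

/-- The edges of `A(f)` all cross the split `i`. -/
def Crosses (d : X → X → ℝ) (f : X → ℝ) (A : Set X) : Prop :=
  ∀ x y, f x + f y = d x y → ¬ (x ∈ A ↔ y ∈ A)

/-- The position of the split `i` in every function of the cell of `f`, if not all edges of
`A(f)` cross it. -/
lemma exists_splitFun_eq {f : X → ℝ} (J : Finset ι)
    (hJ : ∀ i, i ∉ J → ¬ Crosses d f (D.A i)) :
    ∃ τ : ι → ℝ, ∀ h ∈ DeltaSet (D.rest J),
      (∀ x y, f x + f y = d x y → h x + h y = D.rest J x y) →
      ∀ x u, f x + f u = d x u → ∃ G : Finset ι, (∀ i, i ∈ G ↔ i ∉ J ∧ ¬ (x ∈ D.A i ↔ u ∈ D.A i)) ∧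
        h x = ∑ i ∈ G, splitFun (D.A i) (D.wt i) (τ i) x := by
  classical
  refine ⟨fun i => if ∃ p q, f p + f q = d p q ∧ p ∈ D.A i ∧ q ∈ D.A i then 0 else D.wt i, ?_⟩
  intro h hh htight x u hxu
  have hG : ∀ i, i ∈ (D.sep_finite x u).toFinset \ J ↔ i ∉ J ∧ ¬ (x ∈ D.A i ↔ u ∈ D.A i) := by
    intro i
    rw [Finset.mem_sdiff, Set.Finite.mem_toFinset, and_comm]
    rfl
  refine ⟨(D.sep_finite x u).toFinset \ J, hG, ?_⟩
  set G := (D.sep_finite x u).toFinset \ J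
  have hdisj : Disjoint J G := Finset.disjoint_sdiff
  obtain ⟨t, ht, hrest⟩ := D.exists_sum_splitFun_sub G hdisj hh
  have hrestG : ∀ p q, D.rest (J ∪ G) p q
      = D.rest J p q - ∑ i ∈ G, D.wt i * splitDist (D.A i) p q := by
    intro p q
    rw [rest, rest, Finset.sum_union hdisj]
    ring
  have hsum : ∀ p q, f p + f q = d p q → ∀ i ∈ G,
      splitFun (D.A i) (D.wt i) (t i) p + splitFun (D.A i) (D.wt i) (t i) q
        = D.wt i * splitDist (D.A i) p q := by
    intro p q hpq i hi
    have h1 := htight p q hpq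
    have h2 := hrest p q
    rw [hrestG] at h2
    have hnn : ∀ j ∈ G, 0 ≤ splitFun (D.A j) (D.wt j) (t j) p
        + splitFun (D.A j) (D.wt j) (t j) q - D.wt j * splitDist (D.A j) p q := fun j _ =>
      sub_nonneg.2 (splitFun_mem_deltaSet (ht j) p q)
    have h3 := Finset.single_le_sum hnn hi
    simp only [Finset.sum_sub_distrib, Finset.sum_add_distrib] at h3
    have h4 := hnn i hi
    linarith
  have hval : ∀ i ∈ G, t i =
      if ∃ p q, f p + f q = d p q ∧ p ∈ D.A i ∧ q ∈ D.A i then 0 else D.wt i := by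
    intro i hi
    split_ifs with hex
    · obtain ⟨p, q, hpq, hp, hq⟩ := hex
      have := hsum p q hpq i hi
      rw [splitFun_of_mem hp, splitFun_of_mem hq, splitDist_of_iff (by tauto)] at this
      linarith
    · have hc := hJ i ((hG i).1 hi).1
      unfold Crosses at hc
      push Not at hc
      obtain ⟨p, q, hpq, hiff⟩ := hc
      have hp : p ∉ D.A i := fun hp => hex ⟨p, q, hpq, hp, hiff.1 hp⟩
      have := hsum p q hpq i hi
      rw [splitFun_of_notMem hp, splitFun_of_notMem (by tauto), splitDist_of_iff hiff] at this
      linarith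
  have hzero : D.rest (J ∪ G) x u = 0 := by
    rw [D.rest_eq_sum (U := (D.sep_finite x u).toFinset) _ (by simp)]
    rw [Finset.sdiff_eq_empty_iff_subset.2, Finset.sum_empty]
    intro i hi
    by_cases hiJ : i ∈ J
    · exact Finset.mem_union_left _ hiJ
    · exact Finset.mem_union_right _ (Finset.mem_sdiff.2 ⟨hi, hiJ⟩)
  have n1 := D.nonneg_of_mem_deltaSet_rest hrest x
  have n2 := D.nonneg_of_mem_deltaSet_rest hrest u
  have h1 := htight x u hxu
  have h2 := hrestG x u
  have h3 := Finset.sum_congr rfl (hsum x u hxu)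
  rw [Finset.sum_add_distrib] at h3
  have h4 : h x = ∑ i ∈ G, splitFun (D.A i) (D.wt i) (t i) x := by linarith
  rw [h4]
  exact Finset.sum_congr rfl fun i hi => by rw [hval i hi]

/-- The cell of `f` is a zonotope generated by the splits crossed by all edges of `A(f)`. -/
theorem cellOf_eq {f : X → ℝ} (hf : f ∈ ExtSet' d) (J : Finset ι)
    (hJ : ∀ i, i ∈ J ↔ Crosses d f (D.A i)) :
    ∃ h : X → ℝ, cellOf d f = {g | ∃ t : ι → ℝ, (∀ i ∈ J, t i ∈ Icc 0 (D.wt i)) ∧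
      g = fun x => h x + ∑ i ∈ J, splitFun (D.A i) (D.wt i) (t i) x} := by
  classical
  obtain ⟨τ, hτ⟩ := D.exists_splitFun_eq (f := f) J fun i hi hc => hi ((hJ i).2 hc)
  have hrest0 : D.rest ∅ = d := by
    funext x y
    simp [rest]
  have hpeel : ∀ g ∈ cellOf d f, ∃ t : ι → ℝ, (∀ i, t i ∈ Icc 0 (D.wt i)) ∧
      (fun x => g x - ∑ i ∈ J, splitFun (D.A i) (D.wt i) (t i) x) ∈ DeltaSet (D.rest J) ∧
      ∀ x y, f x + f y = d x y → (g x - ∑ i ∈ J, splitFun (D.A i) (D.wt i) (t i) x) +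
        (g y - ∑ i ∈ J, splitFun (D.A i) (D.wt i) (t i) y) = D.rest J x y := by
    rintro g ⟨hg1, hg2⟩
    obtain ⟨t, ht, hh⟩ := D.exists_sum_splitFun_sub (F := ∅) J (Finset.disjoint_empty_left J)
      (h := g) (by rwa [hrest0])
    rw [Finset.empty_union] at hh
    refine ⟨t, ht, hh, fun x y hxy => ?_⟩
    have h1 := hg2 x y hxy
    have h2 : ∑ i ∈ J, (splitFun (D.A i) (D.wt i) (t i) x + splitFun (D.A i) (D.wt i) (t i) y)
        = ∑ i ∈ J, D.wt i * splitDist (D.A i) x y := by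
      refine Finset.sum_congr rfl fun i hi => ?_
      have hc := (hJ i).1 hi x y hxy
      rw [splitFun_add_splitFun_of_not_iff hc, splitDist_of_not_iff hc, mul_one]
    rw [Finset.sum_add_distrib] at h2
    rw [rest]
    linarith
  obtain ⟨t₀, ht₀, hh₀, hh₁⟩ := hpeel f ⟨hf.1, fun _ _ h => h⟩
  refine ⟨fun x => f x - ∑ i ∈ J, splitFun (D.A i) (D.wt i) (t₀ i) x, Set.ext fun g => ⟨?_, ?_⟩⟩
  · intro hg
    obtain ⟨t, ht, hg0, hg1⟩ := hpeel g hg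
    refine ⟨t, fun i _ => ht i, funext fun x => ?_⟩
    obtain ⟨u, hu⟩ := hf.2 x
    obtain ⟨G, hG, e⟩ := hτ _ hg0 hg1 x u hu
    obtain ⟨G', hG', e'⟩ := hτ _ hh₀ hh₁ x u hu
    have : G = G' := Finset.ext fun i => by rw [hG, hG']
    subst this
    linarith
  · rintro ⟨t, ht, rfl⟩
    refine ⟨fun x y => ?_, fun x y hxy => ?_⟩
    · have h1 := hh₀ x y
      have h2 := Finset.sum_le_sum fun i (hi : i ∈ J) =>
        splitFun_mem_deltaSet (A := D.A i) (ht i hi) x y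
      rw [Finset.sum_add_distrib] at h2
      rw [rest] at h1
      linarith
    · have h1 := hh₁ x y hxy
      have h2 : ∑ i ∈ J, (splitFun (D.A i) (D.wt i) (t i) x + splitFun (D.A i) (D.wt i) (t i) y)
          = ∑ i ∈ J, D.wt i * splitDist (D.A i) x y := by
        refine Finset.sum_congr rfl fun i hi => ?_
        have hc := (hJ i).1 hi x y hxy
        rw [splitFun_add_splitFun_of_not_iff hc, splitDist_of_not_iff hc, mul_one]
      rw [Finset.sum_add_distrib] at h2
      rw [rest] at h1
      linarith

end SplitDecomp

open Classical in
/-- The function with value `1` on `A` and `-1` off `A`. -/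
def splitSign (A : Set X) (x : X) : ℝ := if x ∈ A then 1 else -1

lemma splitSign_ne_zero (A : Set X) (x : X) : splitSign A x ≠ 0 := by
  unfold splitSign
  split_ifs <;> norm_num

lemma splitSign_eq_of_iff {A : Set X} {x y : X} (h : x ∈ A ↔ y ∈ A) :
    splitSign A x = splitSign A y := by
  unfold splitSign
  by_cases hx : x ∈ A <;> by_cases hy : y ∈ A <;> simp_all

lemma splitSign_eq_neg_of_not_iff {A : Set X} {x y : X} (h : ¬ (x ∈ A ↔ y ∈ A)) :
    splitSign A y = -splitSign A x := by
  unfold splitSign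
  by_cases hx : x ∈ A <;> by_cases hy : y ∈ A <;> simp_all

lemma SplitDecomp.cellOf_eq_zonotope {d : X → X → ℝ} {ι : Type*} (D : SplitDecomp d ι)
    {f : X → ℝ} (hf : f ∈ ExtSet' d) (J : Finset ι)
    (hJ : ∀ i, i ∈ J ↔ SplitDecomp.Crosses d f (D.A i)) :
    ∃ z : X → ℝ, cellOf d f = {g | ∃ s : ι → ℝ, (∀ i ∈ J, s i ∈ Icc (0 : ℝ) 1) ∧
      g = z + ∑ i ∈ J, s i • (D.wt i • splitSign (D.A i))} := by
  obtain ⟨h, hh⟩ := D.cellOf_eq hf J hJ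
  have key : ∀ i s x, splitFun (D.A i) (D.wt i) (s * D.wt i) x =
      splitFun (D.A i) (D.wt i) 0 x + s * (D.wt i * splitSign (D.A i) x) := by
    intro i s x
    unfold splitFun splitSign
    split_ifs <;> ring
  refine ⟨fun x => h x + ∑ i ∈ J, splitFun (D.A i) (D.wt i) 0 x, ?_⟩
  rw [hh]
  ext g
  constructor
  · rintro ⟨t, ht, rfl⟩
    refine ⟨fun i => t i / D.wt i, fun i hi => ?_, ?_⟩
    · have := ht i hi
      have hw := D.wt_pos i
      exact ⟨div_nonneg this.1 hw.le, (div_le_one hw).2 this.2⟩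
    · funext x
      have : ∀ i, splitFun (D.A i) (D.wt i) (t i) x = splitFun (D.A i) (D.wt i) 0 x +
          t i / D.wt i * (D.wt i * splitSign (D.A i) x) := by
        intro i
        rw [← key, div_mul_cancel₀ _ (D.wt_pos i).ne']
      simp only [this, Finset.sum_add_distrib, Pi.add_apply, Finset.sum_apply, Pi.smul_apply,
        smul_eq_mul]
      ring
  · rintro ⟨s, hs, rfl⟩
    refine ⟨fun i => s i * D.wt i, fun i hi => ?_, ?_⟩
    · have := hs i hi
      have hw := D.wt_pos i
      exact ⟨mul_nonneg this.1 hw.le, mul_le_of_le_one_left hw.le this.2⟩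
    · funext x
      simp only [key, Finset.sum_add_distrib, Pi.add_apply, Finset.sum_apply, Pi.smul_apply,
        smul_eq_mul]
      ring

/-- A pattern of four split sides on antipodal pairs determines an octahedral partition. -/
lemma exists_octPartition_of_pattern {S₀ K P Q : X → Prop}
    (hanti : ∀ y, ∃ u, (S₀ u ↔ ¬ S₀ y) ∧ (K u ↔ ¬ K y) ∧ (P u ↔ ¬ P y) ∧ (Q u ↔ ¬ Q y))
    (hpat : ∀ y, ¬ S₀ y → (K y ↔ P y ∨ Q y) ∧ ¬ (P y ∧ Q y))
    {x a z : X} (hx : ¬ S₀ x ∧ ¬ K x) (ha : ¬ S₀ a ∧ P a) (hz : ¬ S₀ z ∧ Q z) :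
    ∃ Y : Fin 3 → Bool → Set X, OctPartition Y ∧ octPart Y true true = {y | ¬ S₀ y} ∧
      octPart Y true false = {y | ¬ Q y} ∧ octPart Y false true = {y | ¬ P y} ∧
      octPart Y false false = {y | ¬ K y} := by
  have hpat' : ∀ y, S₀ y → (¬ K y ↔ ¬ P y ∨ ¬ Q y) ∧ (P y ∨ Q y) := by
    intro y hy
    obtain ⟨u, h1, h2, h3, h4⟩ := hanti y
    have := hpat u (by rw [h1]; exact not_not.2 hy)
    rw [h2, h3, h4] at this
    grind
  let E : Fin 3 → X → Prop := ![fun y => (K y ↔ S₀ y),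
    fun y => ¬ (K y ↔ S₀ y) ∧ (Q y ↔ S₀ y), fun y => ¬ (K y ↔ S₀ y) ∧ (P y ↔ S₀ y)]
  have E0 : ∀ y, E 0 y ↔ (K y ↔ S₀ y) := fun y => Iff.rfl
  have E1 : ∀ y, E 1 y ↔ ¬ (K y ↔ S₀ y) ∧ (Q y ↔ S₀ y) := fun y => Iff.rfl
  have E2 : ∀ y, E 2 y ↔ ¬ (K y ↔ S₀ y) ∧ (P y ↔ S₀ y) := fun y => Iff.rfl
  clear_value E
  have hEanti : ∀ y, ∃ u, (S₀ u ↔ ¬ S₀ y) ∧ ∀ i, E i u ↔ E i y := by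
    intro y
    obtain ⟨u, h1, h2, h3, h4⟩ := hanti y
    refine ⟨u, h1, fun i => ?_⟩
    clear hpat hpat' hanti
    match i with
    | 0 => grind
    | 1 => grind
    | 2 => grind
  have hEx : ∀ i, ∃ y, ¬ S₀ y ∧ E i y := by
    intro i
    fin_cases i
    · exact ⟨x, hx.1, (E0 x).2 (by grind)⟩
    · exact ⟨a, ha.1, (E1 a).2 (by have := hpat a ha.1; grind)⟩
    · exact ⟨z, hz.1, (E2 z).2 (by have := hpat z hz.1; grind)⟩
  have hEdisj : ∀ i j y, E i y → E j y → i = j := by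
    intro i j y hi hj
    have p1 := hpat y
    have p2 := hpat' y
    have q0 := E0 y
    have q1 := E1 y
    have q2 := E2 y
    match i, j with
    | 0, 0 | 1, 1 | 2, 2 => rfl
    | 0, 1 | 0, 2 | 1, 0 | 1, 2 | 2, 0 | 2, 1 => grind
  have hEcov : ∀ y, ∃ i, E i y := by
    intro y
    have p1 := hpat y
    have p2 := hpat' y
    by_cases h0 : K y ↔ S₀ y
    · exact ⟨0, (E0 y).2 h0⟩
    · by_cases h2 : Q y ↔ S₀ y
      · exact ⟨1, (E1 y).2 ⟨h0, h2⟩⟩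
      · exact ⟨2, (E2 y).2 ⟨h0, by grind⟩⟩
  have hmem : ∀ b c y, y ∈ octPart (fun i b => {y | (¬ S₀ y ↔ b = true) ∧ E i y}) b c ↔
      (¬ S₀ y ∧ E 0 y) ∨ ((¬ S₀ y ↔ b = true) ∧ E 1 y) ∨ ((¬ S₀ y ↔ c = true) ∧ E 2 y) := by
    intro b c y
    simp [octPart, or_assoc]
  refine ⟨fun i b => {y | (¬ S₀ y ↔ b = true) ∧ E i y}, ⟨?_, ?_, ?_⟩, ?_⟩
  · intro i b
    obtain ⟨y, hy, hE⟩ := hEx i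
    cases b
    · obtain ⟨u, hu, hu'⟩ := hEanti y
      exact ⟨u, by simp [hu, hy], (hu' i).2 hE⟩
    · exact ⟨y, by simp [hy], hE⟩
  · intro i b j c hne
    rw [Set.disjoint_left]
    rintro y ⟨h1, h2⟩ ⟨h3, h4⟩
    refine hne ?_
    rw [hEdisj i j y h2 h4, Bool.eq_iff_iff.2 (h1.symm.trans h3)]
  · refine Set.eq_univ_of_forall fun y => ?_
    obtain ⟨i, hi⟩ := hEcov y
    rw [Set.mem_iUnion]
    refine ⟨i, ?_⟩
    rw [Set.mem_iUnion]
    by_cases h : S₀ y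
    · exact ⟨false, by simp [h], hi⟩
    · exact ⟨true, by simp [h], hi⟩
  · refine ⟨?_, ?_, ?_, ?_⟩ <;> ext y <;> rw [hmem, Set.mem_ofPred_eq, E0, E1, E2] <;>
      have p1 := hpat y <;> have p2 := hpat' y <;> grind

/-- A dependent antipodal family of pairwise distinct weakly compatible splits contains an
octahedral one. -/
theorem exists_octPartition {ι : Type*} [Nonempty X] {A : ι → Set X} {J : Finset ι}
    (hJ : J.Nonempty) (hweak : ∀ i j k, WeaklyCompatible (A i) (A j) (A k))
    (hanti : ∀ x, ∃ u, ∀ i ∈ J, ¬ (x ∈ A i ↔ u ∈ A i))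
    (hdist : ∀ i ∈ J, ∀ j ∈ J, i ≠ j → A i ≠ A j ∧ A i ≠ (A j)ᶜ)
    {c : ι → ℝ} (hc : ∀ i ∈ J, c i ≠ 0) (hsum : ∀ x, ∑ i ∈ J, c i * splitSign (A i) x = 0) :
    ∃ Y : Fin 3 → Bool → Set X, OctPartition Y ∧
      ∀ b c, ∃ i ∈ J, octPart Y b c = A i ∨ octPart Y b c = (A i)ᶜ := by
  classical
  obtain ⟨i₀, hi₀⟩ := hJ
  obtain ⟨x⟩ := ‹Nonempty X›
  let S : ι → X → Prop := fun i y => ¬ (x ∈ A i ↔ y ∈ A i)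
  have hSx : ∀ i, ¬ S i x := fun i h => h Iff.rfl
  have hSanti : ∀ y, ∃ u, ∀ i ∈ J, (S i u ↔ ¬ S i y) := by
    intro y
    obtain ⟨u, hu⟩ := hanti y
    refine ⟨u, fun i hi => ?_⟩
    have := hu i hi
    simp only [S]
    tauto
  have hSweak : ∀ i j k x₁ x₂ x₃, ¬ S i x₁ → S i x₂ → S i x₃ → S j x₁ → ¬ S j x₂ → S j x₃ →
      S k x₁ → S k x₂ → ¬ S k x₃ → False := by
    intro i j k x₁ x₂ x₃ a1 a2 a3 b1 b2 b3 c1 c2 c3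
    exact hweak i j k x x₁ x₂ x₃ (not_not.1 a1) a2 a3 b1 (not_not.1 b2) b3 c1 c2 (not_not.1 c3)
  have hSeq : ∀ i ∈ J, ∀ j ∈ J, (∀ y, S i y ↔ S j y) → i = j := by
    intro i hi j hj h
    by_contra hne
    obtain ⟨h1, h2⟩ := hdist i hi j hj hne
    by_cases hx : x ∈ A i ↔ x ∈ A j
    · refine h1 (Set.ext fun y => ?_)
      have := h y
      simp only [S] at this
      tauto
    · refine h2 (Set.ext fun y => ?_)
      have := h y
      simp only [S] at this
      rw [Set.mem_compl_iff]
      tauto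
  let L : ι → Set X := fun j => {y | ¬ S i₀ y ∧ S j y}
  have hLne : ∀ j ∈ J, j ≠ i₀ → (L j).Nonempty := by
    intro j hj hne
    by_contra hemp
    have hemp' : ∀ y, ¬ S i₀ y → ¬ S j y := fun y h1 h2 => hemp ⟨y, h1, h2⟩
    refine hne (hSeq j hj i₀ hi₀ fun y => ⟨fun h => ?_, fun h => ?_⟩)
    · by_cases h' : S i₀ y
      · exact h'
      · exact absurd h (hemp' y h')
    · by_cases h' : S j y
      · exact h'
      · obtain ⟨u, hu⟩ := hSanti y
        exact absurd ((hu j hj).2 h') (hemp' u fun h'' => (hu i₀ hi₀).1 h'' h)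
  have hLinj : ∀ j ∈ J, ∀ k ∈ J, L j ⊆ L k → L k ⊆ L j → j = k := by
    intro j hj k hk h1 h2
    have h3 : ∀ y, ¬ S i₀ y → (S j y ↔ S k y) := fun y hy =>
      ⟨fun h => (h1 ⟨hy, h⟩).2, fun h => (h2 ⟨hy, h⟩).2⟩
    refine hSeq j hj k hk fun y => ?_
    by_cases hy : S i₀ y
    · obtain ⟨u, hu⟩ := hSanti y
      have h4 := h3 u fun h => (hu i₀ hi₀).1 h hy
      rw [hu j hj, hu k hk] at h4
      exact not_iff_not.1 h4
    · exact h3 y hy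
  have hlam : ∀ j ∈ J, ∀ k ∈ J, L j ⊆ L k ∨ L k ⊆ L j ∨ ∀ y ∈ L j, y ∉ L k := by
    intro j hj k hk
    by_contra! h
    obtain ⟨h1, h2, y, hyj, hyk⟩ := h
    obtain ⟨z, hz, hz'⟩ := Set.not_subset.1 h1
    obtain ⟨w, hw, hw'⟩ := Set.not_subset.1 h2
    obtain ⟨z', e⟩ := hSanti z
    obtain ⟨w', e'⟩ := hSanti w
    refine hSweak i₀ j k y z' w' hyj.1 ?_ ?_ hyj.2 ?_ ?_ hyk.2 ?_ ?_
    · rw [e _ hi₀]; exact hz.1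
    · rw [e' _ hi₀]; exact hw.1
    · rw [e _ hj]; exact not_not.2 hz.2
    · rw [e' _ hj]; exact fun h => hw' ⟨hw.1, h⟩
    · rw [e _ hk]; exact fun h => hz' ⟨hz.1, h⟩
    · rw [e' _ hk]; exact not_not.2 hw.2
  have hJ' : (J.erase i₀).Nonempty := by
    rw [Finset.nonempty_iff_ne_empty]
    intro h
    have h1 := hsum x
    rw [← Finset.add_sum_erase J _ hi₀, h, Finset.sum_empty, add_zero] at h1
    exact mul_ne_zero (hc _ hi₀) (splitSign_ne_zero _ _) h1
  obtain ⟨k, hkJ', hkmax⟩ := Finset.exists_maximalFor L _ hJ'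
  have hk : k ∈ J := Finset.mem_of_mem_erase hkJ'
  have hki : k ≠ i₀ := Finset.ne_of_mem_erase hkJ'
  let T : Finset ι := (J.erase i₀).filter fun j => L j ⊆ L k ∧ j ≠ k
  have hT : ∀ j, j ∈ T ↔ (j ≠ i₀ ∧ j ∈ J) ∧ L j ⊆ L k ∧ j ≠ k := by simp [T]
  have hcover : ∀ z ∈ L k, ∃ j ∈ T, z ∈ L j := by
    intro z hz
    by_contra! h
    have h1 : ∀ j ∈ J, j ≠ k → ¬ S j z := by
      intro j hj hjk hjz
      have hji : j ≠ i₀ := by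
        rintro rfl
        exact hz.1 hjz
      have hzj : z ∈ L j := ⟨hz.1, hjz⟩
      rcases hlam j hj k hk with h2 | h2 | h2
      · exact h j ((hT j).2 ⟨⟨hji, hj⟩, h2, hjk⟩) hzj
      · exact hjk (hLinj j hj k hk (hkmax (Finset.mem_erase.2 ⟨hji, hj⟩) h2) h2)
      · exact h2 z hzj hz
    have h2 := hsum x
    have h3 := hsum z
    rw [← Finset.add_sum_erase J _ hk] at h2 h3
    rw [Finset.sum_congr rfl (fun j hj => by
      rw [← splitSign_eq_of_iff (not_not.1 (h1 j (Finset.mem_of_mem_erase hj)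
        (Finset.ne_of_mem_erase hj)))]), splitSign_eq_neg_of_not_iff hz.2] at h3
    refine mul_ne_zero (hc _ hk) (splitSign_ne_zero (A k) x) ?_
    linarith
  obtain ⟨z₀, hz₀⟩ := hLne k hk hki
  obtain ⟨j₀, hj₀, -⟩ := hcover z₀ hz₀
  obtain ⟨b₁, hb₁T, hb₁max⟩ := Finset.exists_maximalFor L T ⟨j₀, hj₀⟩
  obtain ⟨⟨hb₁i, hb₁⟩, hb₁k, hb₁ne⟩ := (hT b₁).1 hb₁T
  obtain ⟨z, hzk, hzb₁⟩ : ∃ z ∈ L k, z ∉ L b₁ :=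
    Set.not_subset.1 fun h => hb₁ne (hLinj b₁ hb₁ k hk hb₁k h)
  obtain ⟨j₁, hj₁, hzj₁⟩ := hcover z hzk
  obtain ⟨b₂, hb₂T', hb₂max'⟩ := Finset.exists_maximalFor L (T.filter fun j => L j₁ ⊆ L j)
    ⟨j₁, Finset.mem_filter.2 ⟨hj₁, subset_rfl⟩⟩
  obtain ⟨hb₂T, hj₁b₂⟩ := Finset.mem_filter.1 hb₂T'
  have hb₂max : ∀ j ∈ T, L b₂ ⊆ L j → L j ⊆ L b₂ := fun j hj h =>
    hb₂max' (Finset.mem_filter.2 ⟨hj, hj₁b₂.trans h⟩) h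
  obtain ⟨⟨hb₂i, hb₂⟩, hb₂k, hb₂ne⟩ := (hT b₂).1 hb₂T
  have hzb₂ : z ∈ L b₂ := hj₁b₂ hzj₁
  have hdisj : ∀ y ∈ L b₁, y ∉ L b₂ := by
    rcases hlam b₁ hb₁ b₂ hb₂ with h | h | h
    · exact absurd (hb₁max hb₂T h hzb₂) hzb₁
    · exact absurd (h hzb₂) hzb₁
    · exact h
  obtain ⟨a₁, ha₁⟩ := hLne b₁ hb₁ hb₁i
  obtain ⟨a₁', ha₁'⟩ := hSanti a₁
  obtain ⟨z', hz'⟩ := hSanti z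
  have hcover2 : ∀ w ∈ L k, w ∈ L b₁ ∨ w ∈ L b₂ := by
    intro w hw
    by_contra! hwb
    obtain ⟨j, hjT, hwj⟩ := hcover w hw
    obtain ⟨⟨hji, hj⟩, -, -⟩ := (hT j).1 hjT
    have h1 : ∀ y ∈ L b₁, y ∉ L j := by
      rcases hlam b₁ hb₁ j hj with h | h | h
      · exact absurd (hb₁max hjT h hwj) hwb.1
      · exact absurd (h hwj) hwb.1
      · exact h
    have h2 : ∀ y ∈ L b₂, y ∉ L j := by
      rcases hlam b₂ hb₂ j hj with h | h | h
      · exact absurd (hb₂max j hjT h hwj) hwb.2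
      · exact absurd (h hwj) hwb.2
      · exact h
    obtain ⟨w', hw'⟩ := hSanti w
    refine hSweak b₁ b₂ j a₁' z' w' ?_ ?_ ?_ ?_ ?_ ?_ ?_ ?_ ?_
    · rw [ha₁' _ hb₁]; exact not_not.2 ha₁.2
    · rw [hz' _ hb₁]; exact fun h => hzb₁ ⟨hzk.1, h⟩
    · rw [hw' _ hb₁]; exact fun h => hwb.1 ⟨hw.1, h⟩
    · rw [ha₁' _ hb₂]; exact fun h => hdisj _ ha₁ ⟨ha₁.1, h⟩
    · rw [hz' _ hb₂]; exact not_not.2 hzb₂.2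
    · rw [hw' _ hb₂]; exact fun h => hwb.2 ⟨hw.1, h⟩
    · rw [ha₁' _ hj]; exact fun h => h1 _ ha₁ ⟨ha₁.1, h⟩
    · rw [hz' _ hj]; exact fun h => h2 _ hzb₂ ⟨hzk.1, h⟩
    · rw [hw' _ hj]; exact not_not.2 hwj.2
  have hpat : ∀ y, ¬ S i₀ y → (S k y ↔ S b₁ y ∨ S b₂ y) ∧ ¬ (S b₁ y ∧ S b₂ y) := by
    intro y hy
    refine ⟨⟨fun h => ?_, ?_⟩, fun h => hdisj y ⟨hy, h.1⟩ ⟨hy, h.2⟩⟩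
    · exact (hcover2 y ⟨hy, h⟩).imp (fun h => h.2) fun h => h.2
    · rintro (h | h)
      · exact (hb₁k ⟨hy, h⟩).2
      · exact (hb₂k ⟨hy, h⟩).2
  have hside : ∀ i, {y | ¬ S i y} = A i ∨ {y | ¬ S i y} = (A i)ᶜ := by
    intro i
    by_cases hx : x ∈ A i
    · left
      ext y
      simp [S, hx]
    · right
      ext y
      simp [S, hx]
  obtain ⟨Y, hY, h1, h2, h3, h4⟩ := exists_octPartition_of_pattern (S₀ := S i₀) (K := S k)
    (P := S b₁) (Q := S b₂) (fun y => by
      obtain ⟨u, hu⟩ := hSanti y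
      exact ⟨u, hu _ hi₀, hu _ hk, hu _ hb₁, hu _ hb₂⟩) hpat ⟨hSx i₀, hSx k⟩ ha₁ ⟨hzk.1, hzb₂.2⟩
  refine ⟨Y, hY, fun b c => ?_⟩
  cases b <;> cases c
  · exact ⟨k, hk, h4 ▸ hside k⟩
  · exact ⟨b₁, hb₁, h3 ▸ hside b₁⟩
  · exact ⟨b₂, hb₂, h2 ▸ hside b₂⟩
  · exact ⟨i₀, hi₀, h1 ▸ hside i₀⟩

lemma OctPartition.exists_index {Y : Fin 3 → Bool → Set X} (hY : OctPartition Y) :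
    ∃ κ : X → Fin 3 × Bool, Surjective κ ∧ ∀ i b y, y ∈ Y i b ↔ κ y = (i, b) := by
  obtain ⟨hne, hdisj, hcov⟩ := hY
  have h : ∀ y, ∃ p : Fin 3 × Bool, y ∈ Y p.1 p.2 := by
    intro y
    have hy : y ∈ ⋃ (i) (b), Y i b := hcov ▸ Set.mem_univ y
    simp only [Set.mem_iUnion] at hy
    obtain ⟨i, b, hy⟩ := hy
    exact ⟨(i, b), hy⟩
  choose κ hκ using h
  have hmem : ∀ i b y, y ∈ Y i b ↔ κ y = (i, b) := by
    intro i b y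
    refine ⟨fun hy => ?_, fun hy => ?_⟩
    · by_contra hne
      exact Set.disjoint_left.1 (hdisj (κ y).1 (κ y).2 i b hne) (hκ y) hy
    · have := hκ y
      rwa [hy] at this
  refine ⟨κ, fun p => ?_, hmem⟩
  obtain ⟨y, hy⟩ := hne p.1 p.2
  exact ⟨y, (hmem _ _ _).1 hy⟩

/-- The points indexed by the face `σ` of the octahedron. -/
def octFace (κ : X → Fin 3 × Bool) (σ : Fin 3 → Bool) : Set X := {y | (κ y).2 = σ (κ y).1}

lemma mem_octFace {κ : X → Fin 3 × Bool} {σ : Fin 3 → Bool} {y : X} {i : Fin 3} {b : Bool}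
    (h : κ y = (i, b)) : y ∈ octFace κ σ ↔ b = σ i := by
  simp [octFace, h]

lemma octPart_eq_octFace {Y : Fin 3 → Bool → Set X} {κ : X → Fin 3 × Bool}
    (hκ : ∀ i b y, y ∈ Y i b ↔ κ y = (i, b)) (b c : Bool) :
    octPart Y b c = octFace κ ![true, b, c] := by
  ext y
  obtain ⟨⟨i, e⟩, h⟩ : ∃ p, κ y = p := ⟨_, rfl⟩
  rw [mem_octFace h]
  simp only [octPart, Set.mem_union, hκ, h, Prod.mk.injEq]
  fin_cases i <;> simp

lemma octFace_compl (κ : X → Fin 3 × Bool) (σ : Fin 3 → Bool) :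
    (octFace κ σ)ᶜ = octFace κ fun i => !(σ i) := by
  ext y
  simp only [octFace, Set.mem_compl_iff, Set.mem_ofPred_eq]
  cases (κ y).2 <;> cases σ (κ y).1 <;> simp

lemma octFace_eq {Y : Fin 3 → Bool → Set X} {κ : X → Fin 3 × Bool}
    (hκ : ∀ i b y, y ∈ Y i b ↔ κ y = (i, b)) (σ : Fin 3 → Bool) :
    ∃ b c, octFace κ σ = octPart Y b c ∨ octFace κ σ = (octPart Y b c)ᶜ := by
  by_cases h : σ 0 = true
  · refine ⟨σ 1, σ 2, Or.inl ?_⟩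
    rw [octPart_eq_octFace hκ]
    congr 1
    funext i
    fin_cases i <;> simp [h]
  · refine ⟨!(σ 1), !(σ 2), Or.inr ?_⟩
    rw [octPart_eq_octFace hκ, octFace_compl]
    congr 1
    funext i
    fin_cases i <;> simp [h]

/-- Two families of octahedron vertices that cover all vertices and meet all faces cannot both
satisfy the weak compatibility conditions. -/
lemma octahedron_cover_false {a c : Fin 3 → Bool → Prop} (hcov : ∀ i b, a i b ∨ c i b)
    (ha : ∀ σ : Fin 3 → Bool, ∃ q, a q (σ q)) (hc : ∀ σ : Fin 3 → Bool, ∃ q, c q (σ q))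
    (hac : ∀ p (σ : Fin 3 → Bool), a p true → a p false → (∃ q, q ≠ p ∧ c q (σ q)) →
      (∃ q, q ≠ p ∧ c q (!(σ q))) → False)
    (hca : ∀ p (σ : Fin 3 → Bool), c p true → c p false → (∃ q, q ≠ p ∧ a q (σ q)) →
      (∃ q, q ≠ p ∧ a q (!(σ q))) → False) : False := by
  have hex : ∀ {e : Fin 3 → Bool → Prop}, (∀ σ : Fin 3 → Bool, ∃ q, e q (σ q)) →
      ∃ p, ∀ b, e p b := by
    intro e he
    by_contra! h
    choose σ hσ using h
    obtain ⟨q, hq⟩ := he σ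
    exact hσ q hq
  have hpair : ∀ {e f : Fin 3 → Bool → Prop} {p : Fin 3}, (∀ b, e p b) →
      (∀ p (σ : Fin 3 → Bool), e p true → e p false → (∃ q, q ≠ p ∧ f q (σ q)) →
        (∃ q, q ≠ p ∧ f q (!(σ q))) → False) →
      ∀ q b r b', q ≠ p → r ≠ p → (q, b) ≠ (r, b') → f q b → f r b' → False := by
    intro e f p hp h q b r b' hq hr hne h1 h2
    refine h p (fun i => if i = q then b else !b') (hp _) (hp _) ⟨q, hq, by simpa using h1⟩
      ⟨r, hr, ?_⟩
    by_cases hrq : r = q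
    · subst hrq
      have : b' = !b := by
        cases b <;> cases b' <;> simp_all
      simpa [← this] using h2
    · simpa [hrq] using h2
  obtain ⟨p, hp⟩ := hex ha
  obtain ⟨p', hp'⟩ := hex hc
  have hpp : p' = p := by
    by_contra hne
    exact hpair hp hac p' true p' false hne hne (by simp) (hp' _) (hp' _)
  subst hpp
  have h1 := hpair hp hac
  have h2 := hpair hp' hca
  obtain ⟨q, r, hq, hr, hqr⟩ : ∃ q r : Fin 3, q ≠ p' ∧ r ≠ p' ∧ q ≠ r := by
    clear * -
    revert p'
    decide
  have e1 : (q, true) ≠ (q, false) := by simp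
  have e2 : (q, true) ≠ (r, true) := by simp [hqr]
  have e3 : (q, false) ≠ (r, true) := by simp [hqr]
  rcases hcov q true with k1 | k1 <;> rcases hcov q false with k2 | k2 <;>
    rcases hcov r true with k3 | k3
  · exact h2 _ _ _ _ hq hq e1 k1 k2
  · exact h2 _ _ _ _ hq hq e1 k1 k2
  · exact h2 _ _ _ _ hq hr e2 k1 k3
  · exact h1 _ _ _ _ hq hr e3 k2 k3
  · exact h2 _ _ _ _ hq hr e3 k2 k3
  · exact h1 _ _ _ _ hq hr e2 k1 k3
  · exact h1 _ _ _ _ hq hq e1 k1 k2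
  · exact h1 _ _ _ _ hq hq e1 k1 k2

/-- Every `d`-split is compatible with one of the splits of an octahedral system of `d`-splits. -/
theorem OctPartition.exists_compatSplits {d : X → X → ℝ} (hsymm : ∀ x y, d x y = d y x)
    {Y : Fin 3 → Bool → Set X} (hY : OctPartition Y)
    (hd : ∀ b c, IsDSplit d (octPart Y b c) (octPart Y b c)ᶜ) {A : Set X} (hA : IsDSplit d A Aᶜ) :
    ∃ b c, CompatSplits A (octPart Y b c) := by
  by_contra! h
  obtain ⟨κ, hκs, hκ⟩ := hY.exists_index
  have hface : ∀ σ, IsDSplit d (octFace κ σ) (octFace κ σ)ᶜ := by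
    intro σ
    obtain ⟨b, c, h | h⟩ := octFace_eq hκ σ <;> rw [h]
    · exact hd b c
    · exact (hd b c).compl hsymm
  have hmeet : ∀ σ, (∃ y ∈ A, y ∈ octFace κ σ) ∧ ∃ y ∉ A, y ∈ octFace κ σ := by
    intro σ
    obtain ⟨b, c, hbc⟩ := octFace_eq hκ σ
    have h' := h b c
    simp only [CompatSplits, not_or, Set.not_subset, Set.mem_compl_iff, not_not] at h'
    obtain ⟨⟨y₁, h1, h1'⟩, ⟨y₂, h2, h2'⟩, ⟨y₃, h3, h3'⟩, y₄, h4, h4'⟩ := h'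
    rcases hbc with hbc | hbc <;> rw [hbc]
    · exact ⟨⟨y₃, h3, h3'⟩, y₂, h2', h2⟩
    · exact ⟨⟨y₁, h1, h1'⟩, y₄, h4', h4⟩
  have hside : ∀ {B : Set X}, IsDSplit d B Bᶜ → ∀ p (σ : Fin 3 → Bool),
      (∃ y ∈ B, κ y = (p, true)) → (∃ y ∈ B, κ y = (p, false)) →
      (∃ q, q ≠ p ∧ ∃ y ∉ B, κ y = (q, σ q)) → (∃ q, q ≠ p ∧ ∃ y ∉ B, κ y = (q, !(σ q))) →
      False := by
    rintro B hB p σ ⟨y₀, hy₀, k₀⟩ ⟨y₁, hy₁, k₁⟩ ⟨q, hq, y₂, hy₂, k₂⟩ ⟨r, hr, y₃, hy₃, k₃⟩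
    refine hB.weaklyCompatible hsymm (hface (update σ p true))
      (hface (update (fun i => !(σ i)) p true)) y₀ y₁ y₂ y₃ ?_ ?_ ?_ ?_ ?_ ?_ ?_ ?_ ?_ <;>
      simp [mem_octFace k₀, mem_octFace k₁, mem_octFace k₂, mem_octFace k₃, hq, hr, hy₀, hy₁,
        hy₂, hy₃]
  refine octahedron_cover_false (a := fun i b => ∃ y ∈ A, κ y = (i, b))
    (c := fun i b => ∃ y ∉ A, κ y = (i, b)) ?_ ?_ ?_ (fun p σ => hside hA p σ) fun p σ => ?_
  · intro i b
    obtain ⟨y, hy⟩ := hκs (i, b)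
    by_cases hyA : y ∈ A
    · exact Or.inl ⟨y, hyA, hy⟩
    · exact Or.inr ⟨y, hyA, hy⟩
  · intro σ
    obtain ⟨y, hy, hy'⟩ := (hmeet σ).1
    exact ⟨(κ y).1, y, hy, Prod.ext rfl hy'⟩
  · intro σ
    obtain ⟨y, hy, hy'⟩ := (hmeet σ).2
    exact ⟨(κ y).1, y, hy, Prod.ext rfl hy'⟩
  · have := hside (hA.compl hsymm) p σ
    simp only [Set.mem_compl_iff, not_not] at this
    exact this

/-- Two parametrizations of the same zonotope: a generator of the first one that is separated from
the others by a linear functional is a multiple of some generator of the second one. -/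
lemma exists_smul_eq_of_zonotope_eq {V ι : Type*} [AddCommGroup V] [Module ℝ V] {J : Finset ι}
    {n : ℕ} {u : ι → V} {w : Fin n → V} {z g₀ : V}
    (h : {g | ∃ t : ι → ℝ, (∀ i ∈ J, t i ∈ Icc (0 : ℝ) 1) ∧ g = z + ∑ i ∈ J, t i • u i} =
      {g | ∃ s : Fin n → ℝ, (∀ i, s i ∈ Icc (0 : ℝ) 1) ∧ g = g₀ + ∑ i, s i • w i})
    {i₀ : ι} (hi₀ : i₀ ∈ J) (hu : u i₀ ≠ 0) {ℓ : V →ₗ[ℝ] ℝ} (hℓ₀ : ℓ (u i₀) = 0)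
    (hℓ : ∀ i ∈ J, i ≠ i₀ → 0 < ℓ (u i)) (hw : ∀ j, w j ≠ 0) :
    ∃ (j : Fin n) (c : ℝ), c ≠ 0 ∧ w j = c • u i₀ := by
  classical
  have hle : ∀ t : ι → ℝ, (∀ i ∈ J, t i ∈ Icc (0 : ℝ) 1) →
      ∑ i ∈ J, t i * ℓ (u i) ≤ ∑ i ∈ J, ℓ (u i) := by
    intro t ht
    refine Finset.sum_le_sum fun i hi => ?_
    by_cases hii : i = i₀
    · simp [hii, hℓ₀]
    · exact mul_le_of_le_one_left (hℓ i hi hii).le (ht i hi).2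
  have hface : ∀ t : ι → ℝ, (∀ i ∈ J, t i ∈ Icc (0 : ℝ) 1) →
      ∑ i ∈ J, t i * ℓ (u i) = ∑ i ∈ J, ℓ (u i) → ∀ i ∈ J, i ≠ i₀ → t i = 1 := by
    intro t ht heq i hi hii
    have := (Finset.sum_eq_sum_iff_of_le (f := fun i => t i * ℓ (u i)) (g := fun i => ℓ (u i))
      (s := J) (fun i hi => by
        by_cases hii : i = i₀
        · simp [hii, hℓ₀]
        · exact mul_le_of_le_one_left (hℓ i hi hii).le (ht i hi).2)).1 heq i hi
    exact mul_right_cancel₀ (hℓ i hi hii).ne' (by rw [this, one_mul])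
  let p : V := z + ∑ i ∈ J.erase i₀, u i
  have hval : ∀ t : ι → ℝ, (∀ i ∈ J, i ≠ i₀ → t i = 1) →
      z + ∑ i ∈ J, t i • u i = p + t i₀ • u i₀ := by
    intro t ht
    rw [← Finset.sum_erase_add J _ hi₀, Finset.sum_congr rfl fun i hi => by
      rw [ht i (Finset.mem_of_mem_erase hi) (Finset.ne_of_mem_erase hi), one_smul], add_assoc]
  have hℓp : ℓ p = ℓ z + ∑ i ∈ J, ℓ (u i) := by
    simp only [p, map_add, map_sum]
    rw [← Finset.sum_erase_add J _ hi₀, hℓ₀, add_zero]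
  have hmem : ∀ e : ℝ, e ∈ Icc (0 : ℝ) 1 → p + e • u i₀ ∈
      {g | ∃ t : ι → ℝ, (∀ i ∈ J, t i ∈ Icc (0 : ℝ) 1) ∧ g = z + ∑ i ∈ J, t i • u i} := by
    intro e he
    refine ⟨fun i => if i = i₀ then e else 1, fun i _ => ?_, ?_⟩
    · by_cases hii : i = i₀ <;> simp [hii, he.1, he.2]
    · rw [hval _ fun i _ hii => if_neg hii]
      simp
  have hZ : ∀ g ∈ {g | ∃ t : ι → ℝ, (∀ i ∈ J, t i ∈ Icc (0 : ℝ) 1) ∧ g = z + ∑ i ∈ J, t i • u i},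
      ℓ g ≤ ℓ p ∧ (ℓ g = ℓ p → ∃ e : ℝ, g = p + e • u i₀) := by
    rintro g ⟨t, ht, rfl⟩
    rw [hℓp, map_add, map_sum]
    simp only [map_smul, smul_eq_mul]
    refine ⟨by linarith [hle t ht], fun heq => ⟨t i₀, ?_⟩⟩
    exact hval t (hface t ht (by linarith))
  have hp := hmem 0 (by simp)
  have hq := hmem 1 (by simp)
  rw [h] at hp hq
  obtain ⟨s, hs, hps⟩ := hp
  obtain ⟨s', hs', hqs⟩ := hq
  rw [zero_smul, add_zero] at hps
  rw [one_smul] at hqs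
  obtain ⟨j, hj⟩ : ∃ j, s j ≠ s' j := by
    by_contra! hall
    rw [← funext hall, ← hps] at hqs
    exact hu (by simpa using hqs)
  have hupd : ∀ r : Fin n → ℝ, (∀ i, r i ∈ Icc (0 : ℝ) 1) → ∀ e ∈ Icc (0 : ℝ) 1,
      (g₀ + ∑ i, r i • w i) + (e - r j) • w j ∈
        {g | ∃ s : Fin n → ℝ, (∀ i, s i ∈ Icc (0 : ℝ) 1) ∧ g = g₀ + ∑ i, s i • w i} := by
    intro r hr e he
    refine ⟨update r j e, fun i => ?_, ?_⟩
    · by_cases hij : i = j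
      · subst hij
        simpa using he
      · simpa [hij] using hr i
    · have h1 : ∑ i, update r j e i • w i = ∑ i, r i • w i + (e - r j) • w j := by
        rw [← Finset.sum_erase_add _ _ (Finset.mem_univ j),
          ← Finset.sum_erase_add _ (fun i => r i • w i) (Finset.mem_univ j), update_self,
          Finset.sum_congr rfl fun i hi => by rw [update_of_ne (Finset.ne_of_mem_erase hi)],
          sub_smul]
        abel
      rw [h1, add_assoc]
  have h1 := hupd s hs (s' j) (hs' j)
  have h2 := hupd s' hs' (s j) (hs j)
  rw [← hps, ← h] at h1
  rw [← hqs, ← h] at h2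
  obtain ⟨h1le, h1eq⟩ := hZ _ h1
  obtain ⟨h2le, -⟩ := hZ _ h2
  simp only [map_add, map_smul, smul_eq_mul, hℓ₀] at h1le h2le h1eq
  obtain ⟨e, he⟩ := h1eq (by linarith)
  have he' : (s' j - s j) • w j = e • u i₀ := add_left_cancel he
  have hne : s' j - s j ≠ 0 := sub_ne_zero.2 (Ne.symm hj)
  have hwj : w j = ((s' j - s j)⁻¹ * e) • u i₀ := by
    rw [mul_smul, ← he', smul_smul, inv_mul_cancel₀ hne, one_smul]
  refine ⟨j, _, fun h0 => hw j ?_, hwj⟩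
  rw [hwj, h0, zero_smul]

/-- The `d`-splits, each represented by its part containing the base point `x₀`. -/
abbrev BaseSplit (d : X → X → ℝ) (x₀ : X) : Type _ := {A : Set X // IsDSplit d A Aᶜ ∧ x₀ ∈ A}

lemma BaseSplit.ne_compl {d : X → X → ℝ} {x₀ : X} (i j : BaseSplit d x₀) : i.1 ≠ (j.1)ᶜ := by
  intro h
  have := i.2.2
  rw [h] at this
  exact this j.2.2

lemma exists_baseSplit {d : X → X → ℝ} (hsymm : ∀ x y, d x y = d y x) (x₀ : X) {A : Set X}
    (hA : IsDSplit d A Aᶜ) : ∃ i : BaseSplit d x₀, A = i.1 ∨ A = (i.1)ᶜ := by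
  by_cases h : x₀ ∈ A
  · exact ⟨⟨A, hA, h⟩, Or.inl rfl⟩
  · exact ⟨⟨Aᶜ, hA.compl hsymm, h⟩, Or.inr (compl_compl A).symm⟩

open Classical in
lemma BaseSplit.bijOn_side {d : X → X → ℝ} (hsymm : ∀ x y, d x y = d y x) (x₀ x y : X) :
    Set.BijOn (fun i : BaseSplit d x₀ => if x ∈ i.1 then i.1 else (i.1)ᶜ)
      {i | ¬ (x ∈ i.1 ↔ y ∈ i.1)} {A : Set X | IsDSplit d A Aᶜ ∧ x ∈ A ∧ y ∉ A} := by
  refine ⟨?_, ?_, ?_⟩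
  · intro i hi
    have hi' : ¬ (x ∈ i.1 ↔ y ∈ i.1) := hi
    by_cases hx : x ∈ i.1
    · simp only [hx, if_true]
      exact ⟨i.2.1, hx, by tauto⟩
    · simp only [hx, if_false]
      exact ⟨i.2.1.compl hsymm, hx, by rw [Set.mem_compl_iff]; tauto⟩
  · intro i _ j _ hij
    refine Subtype.ext ?_
    dsimp only at hij
    split_ifs at hij with h1 h2 h2
    · exact hij
    · exact absurd hij (i.ne_compl j)
    · exact absurd hij.symm (j.ne_compl i)
    · exact compl_injective hij
  · rintro A ⟨hA, hx, hy⟩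
    obtain ⟨i, rfl | hi⟩ := exists_baseSplit hsymm x₀ hA
    · exact ⟨i, fun h => hy (h.1 hx), if_pos hx⟩
    · have hx' : x ∉ i.1 := by rw [hi] at hx; exact hx
      have hy' : y ∈ i.1 := by rw [hi] at hy; exact not_not.1 hy
      exact ⟨i, fun h => hx' (h.2 hy'), by simp only [hx', if_false]; exact hi.symm⟩

/-- A totally split-decomposable metric as a sum over its `d`-splits. -/
def TSD.splitDecomp {d : X → X → ℝ} (hTSD : TSD d) (hmet : IsMetric d) (x₀ : X) :
    SplitDecomp d (BaseSplit d x₀) where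
  A i := i.1
  wt i := isolIdx d i.1 (i.1)ᶜ
  wt_pos i := i.2.1.2
  sep_finite x y := by
    rw [(BaseSplit.bijOn_side hmet.1.2.1 x₀ x y).finite_iff_finite]
    by_cases hxy : x = y
    · subst hxy
      simp
    · by_contra hinf
      refine hxy (hmet.2 x y ?_)
      rw [hTSD x y]
      refine finsum_mem_eq_zero_of_infinite ?_
      rwa [Set.inter_eq_left.2]
      exact fun A hA => hA.1.2.ne'
  dist_eq x y := by
    rw [hTSD x y, ← finsum_mem_eq_of_bijOn _ (BaseSplit.bijOn_side hmet.1.2.1 x₀ x y)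
      (f := fun i => isolIdx d i.1 (i.1)ᶜ), finsum_mem_def]
    · refine finsum_congr fun i => ?_
      by_cases h : x ∈ i.1 ↔ y ∈ i.1
      · rw [splitDist_of_iff h, mul_zero, Set.indicator_of_notMem (not_not.2 h)]
      · rw [splitDist_of_not_iff h, mul_one, Set.indicator_of_mem h]
    · intro i _
      split_ifs
      · rfl
      · rw [compl_compl, isolIdx_comm hmet.1.2.1]
  weak i j k := i.2.1.weaklyCompatible hmet.1.2.1 j.2.1 k.2.1

/-- The sign vectors of finitely many crossed `d`-splits are linearly independent unless they
contain an octahedral system. -/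
lemma linearIndependent_splitSign {d : X → X → ℝ} {ι : Type*} [Nonempty X] (D : SplitDecomp d ι)
    (hne : ∀ i j, i ≠ j → D.A i ≠ D.A j ∧ D.A i ≠ (D.A j)ᶜ) {f : X → ℝ} (hf : f ∈ ExtSet' d)
    (hoct : ∀ Y : Fin 3 → Bool → Set X, OctPartition Y →
      ¬ ∀ b c, ∃ i, octPart Y b c = D.A i ∨ octPart Y b c = (D.A i)ᶜ) :
    LinearIndependent ℝ fun i : {i | SplitDecomp.Crosses d f (D.A i)} => splitSign (D.A i) := by
  classical
  by_contra hdep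
  rw [not_linearIndependent_iff] at hdep
  obtain ⟨s, c, hsum, i₁, hi₁, hci₁⟩ := hdep
  obtain ⟨Y, hY, hYA⟩ := exists_octPartition (J := s.filter fun i => c i ≠ 0)
    (A := fun i : {i | SplitDecomp.Crosses d f (D.A i)} => D.A i) ⟨i₁, by simp [hi₁, hci₁]⟩ (fun i j k => D.weak i j k)
    (fun x => by
      obtain ⟨u, hu⟩ := hf.2 x
      exact ⟨u, fun i _ => i.2 x u hu⟩)
    (fun i _ j _ hij => hne i j fun h => hij (Subtype.ext h)) (c := c)
    (fun i hi => (Finset.mem_filter.1 hi).2) fun x => by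
      have := congrFun hsum x
      simp only [Finset.sum_apply, Pi.smul_apply, smul_eq_mul, Pi.zero_apply] at this
      refine Eq.trans (Finset.sum_filter_of_ne fun i _ h h0 => h ?_) this
      rw [h0, zero_mul]
  refine hoct Y hY fun b c => ?_
  obtain ⟨i, -, hi⟩ := hYA b c
  exact ⟨i, hi⟩

lemma splitSign_mem_dirSubmodule {d : X → X → ℝ} {f : X → ℝ} {A : Set X}
    (h : SplitDecomp.Crosses d f A) : splitSign A ∈ dirSubmodule (eqSet d f) := by
  rintro ⟨x, y⟩ hp
  change splitSign A x + splitSign A y = 0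
  rw [splitSign_eq_neg_of_not_iff (h x y hp), add_neg_cancel]

/-- Without octahedral systems among the splits, the cell of `f` is a parallelotope. -/
theorem SplitDecomp.isParallelotope_cellOf {d : X → X → ℝ} {ι : Type*} [Nonempty X]
    (D : SplitDecomp d ι) (hne : ∀ i j, i ≠ j → D.A i ≠ D.A j ∧ D.A i ≠ (D.A j)ᶜ) {f : X → ℝ}
    (hf : f ∈ ExtSet' d)
    (hoct : ∀ Y : Fin 3 → Bool → Set X, OctPartition Y →
      ¬ ∀ b c, ∃ i, octPart Y b c = D.A i ∨ octPart Y b c = (D.A i)ᶜ)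
    {N : ℕ} (hN : Module.rank ℝ (dirSubmodule (eqSet d f)) ≤ N) :
    IsParallelotope (cellOf d f) := by
  classical
  have hli := linearIndependent_splitSign D hne hf hoct
  have hli' : LinearIndependent ℝ fun i : {i | Crosses d f (D.A i)} =>
      (⟨splitSign (D.A i), splitSign_mem_dirSubmodule i.2⟩ : dirSubmodule (eqSet d f)) :=
    LinearIndependent.of_comp (dirSubmodule (eqSet d f)).subtype hli
  have hcard := hli'.cardinal_lift_le_rank
  have hfin : {i | Crosses d f (D.A i)}.Finite := by
    rw [← Set.finite_coe_iff, ← Cardinal.lt_aleph0_iff_finite]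
    have h1 := hcard.trans (Cardinal.lift_le.2 hN)
    rw [Cardinal.lift_natCast] at h1
    exact Cardinal.lift_lt_aleph0.1 (h1.trans_lt (Cardinal.natCast_lt_aleph0))
  obtain ⟨z, hz⟩ := D.cellOf_eq_zonotope hf hfin.toFinset fun i => by simp
  let e := hfin.toFinset.equivFin.symm
  have hmem : ∀ j, Crosses d f (D.A (e j)) := fun j => hfin.mem_toFinset.1 (e j).2
  refine ⟨_, fun j => D.wt (e j) • splitSign (D.A (e j)), z, ?_, ?_⟩
  · have h1 : LinearIndependent ℝ fun j => splitSign (D.A (e j)) :=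
      hli.comp (fun j => ⟨e j, hmem j⟩) fun j k h =>
        e.injective (Subtype.ext (Subtype.mk.inj h))
    exact h1.units_smul fun j => Units.mk0 _ (D.wt_pos (e j)).ne'
  · have hsum : ∀ s : ι → ℝ, ∑ i ∈ hfin.toFinset, s i • (D.wt i • splitSign (D.A i)) =
        ∑ j, s (e j) • (D.wt (e j) • splitSign (D.A (e j))) := by
      intro s
      rw [← Finset.sum_coe_sort, ← e.sum_comp]
    rw [hz]
    ext g
    constructor
    · rintro ⟨s, hs, rfl⟩
      exact ⟨fun j => s (e j), fun j => hs _ (e j).2, by rw [hsum]⟩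
    · rintro ⟨t, ht, rfl⟩
      refine ⟨fun i => if h : i ∈ hfin.toFinset then t (e.symm ⟨i, h⟩) else 0, fun i hi => ?_, ?_⟩
      · simp only [dif_pos hi]
        exact ht _
      · rw [hsum]
        congr 1
        refine Finset.sum_congr rfl fun j _ => ?_
        rw [dif_pos (e j).2]
        simp

/-- The sign attached to a Boolean. -/
def boolSign (b : Bool) : ℝ := if b then 1 else -1

lemma boolSign_true : boolSign true = 1 := rfl

lemma boolSign_false : boolSign false = -1 := rfl

lemma boolSign_mul_self (b : Bool) : boolSign b * boolSign b = 1 := by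
  cases b <;> simp [boolSign]

lemma boolSign_ne_zero (b : Bool) : boolSign b ≠ 0 := by
  cases b <;> simp [boolSign]

lemma splitSign_octPart {Y : Fin 3 → Bool → Set X} {κ : X → Fin 3 × Bool}
    (hκ : ∀ i b y, y ∈ Y i b ↔ κ y = (i, b)) (b c : Bool) {x : X} {i : Fin 3} {e : Bool}
    (hx : κ x = (i, e)) :
    splitSign (octPart Y b c) x = boolSign e * boolSign (![true, b, c] i) := by
  rw [octPart_eq_octFace hκ]
  unfold splitSign
  simp only [mem_octFace hx]
  cases e <;> cases ![true, b, c] i <;> simp [boolSign]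

/-- The four sign vectors of an octahedral system generate no parallelotope. -/
theorem not_isParallelotope_of_octPartition {Y : Fin 3 → Bool → Set X} (hY : OctPartition Y)
    {ι : Type*} {q : Bool → Bool → ι} {J : Finset ι} (hJ : ∀ i, i ∈ J ↔ ∃ b c, q b c = i)
    {A : ι → Set X} (hq : ∀ b c, A (q b c) = octPart Y b c) {r : ι → ℝ} (hr : ∀ i, 0 < r i)
    {z : X → ℝ} : ¬ IsParallelotope {g | ∃ s : ι → ℝ, (∀ i ∈ J, s i ∈ Icc (0 : ℝ) 1) ∧
      g = z + ∑ i ∈ J, s i • (r i • splitSign (A i))} := by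
  rintro ⟨n, w, g₀, hli, heq⟩
  obtain ⟨κ, hκs, hκ⟩ := hY.exists_index
  obtain ⟨y₀, h₀⟩ := hκs (0, true)
  obtain ⟨y₁, h₁⟩ := hκs (1, true)
  obtain ⟨y₂, h₂⟩ := hκs (2, true)
  have hval : ∀ b c, splitSign (octPart Y b c) y₀ = 1 ∧ splitSign (octPart Y b c) y₁ = boolSign b ∧
      splitSign (octPart Y b c) y₂ = boolSign c := by
    intro b c
    rw [splitSign_octPart hκ b c h₀, splitSign_octPart hκ b c h₁, splitSign_octPart hκ b c h₂]
    simp [boolSign_true]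
  have hgen : ∀ b c, ∃ (j : Fin n) (C : ℝ), C ≠ 0 ∧ w j = C • splitSign (octPart Y b c) := by
    intro b c
    let ℓ : (X → ℝ) →ₗ[ℝ] ℝ := (2 : ℝ) • LinearMap.proj y₀ - boolSign b • LinearMap.proj y₁ -
      boolSign c • LinearMap.proj y₂
    have hℓ : ∀ b' c', ℓ (r (q b' c') • splitSign (A (q b' c'))) =
        r (q b' c') * (2 - boolSign b * boolSign b' - boolSign c * boolSign c') := by
      intro b' c'
      obtain ⟨e0, e1, e2⟩ := hval b' c'
      simp [ℓ, hq, e0, e1, e2]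
    have hu : r (q b c) • splitSign (A (q b c)) ≠ 0 := by
      intro h0
      have := congrFun h0 y₀
      simp [hq, (hval b c).1, (hr (q b c)).ne'] at this
    have hℓ₀ : ℓ (r (q b c) • splitSign (A (q b c))) = 0 := by
      rw [hℓ, boolSign_mul_self, boolSign_mul_self]
      ring
    have hℓpos : ∀ i ∈ J, i ≠ q b c → 0 < ℓ (r i • splitSign (A i)) := by
      intro i hi hne
      obtain ⟨b', c', rfl⟩ := (hJ i).1 hi
      rw [hℓ]
      refine mul_pos (hr _) ?_
      have hbc : ¬ (b = b' ∧ c = c') := by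
        rintro ⟨rfl, rfl⟩
        exact hne rfl
      cases b <;> cases c <;> cases b' <;> cases c' <;>
        simp [boolSign_true, boolSign_false] at hbc ⊢ <;> norm_num
    obtain ⟨j, C, hC, hj⟩ := exists_smul_eq_of_zonotope_eq (u := fun i => r i • splitSign (A i)) heq
      ((hJ _).2 ⟨b, c, rfl⟩) hu hℓ₀ hℓpos fun j => hli.ne_zero j
    refine ⟨j, C * r (q b c), mul_ne_zero hC (hr _).ne', ?_⟩
    rw [hj, hq, smul_smul]
  choose j C hC hj using hgen
  have hjinj : Injective fun p : Bool × Bool => j p.1 p.2 := by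
    rintro ⟨b, c⟩ ⟨b', c'⟩ h
    dsimp only at h
    have h1 := hj b c
    rw [h, hj b' c'] at h1
    obtain ⟨e0, e1, e2⟩ := hval b c
    obtain ⟨e0', e1', e2'⟩ := hval b' c'
    have f0 := congrFun h1 y₀
    have f1 := congrFun h1 y₁
    have f2 := congrFun h1 y₂
    simp only [Pi.smul_apply, smul_eq_mul, e0, e1, e2, e0', e1', e2', mul_one] at f0 f1 f2
    rw [f0] at f1 f2
    have g1 := mul_left_cancel₀ (hC b c) f1
    have g2 := mul_left_cancel₀ (hC b c) f2
    clear * - g1 g2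
    cases b <;> cases c <;> cases b' <;> cases c' <;> grind [boolSign_true, boolSign_false]
  have hli' := Fintype.linearIndependent_iff.1 (hli.comp _ hjinj)
    (fun p => boolSign p.1 * boolSign p.2 * (C p.1 p.2)⁻¹) (by
      funext x
      obtain ⟨⟨i, e⟩, hx⟩ : ∃ p, κ x = p := ⟨_, rfl⟩
      have hterm : ∀ b c, boolSign b * boolSign c * (C b c)⁻¹ * w (j b c) x =
          boolSign b * boolSign c * (boolSign e * boolSign (![true, b, c] i)) := by
        intro b c
        rw [hj, Pi.smul_apply, smul_eq_mul, splitSign_octPart hκ b c hx]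
        field_simp [hC b c]
      simp only [Finset.sum_apply, Pi.smul_apply, smul_eq_mul, comp_apply, hterm,
        Fintype.sum_prod_type, Fintype.sum_bool, Pi.zero_apply]
      fin_cases i <;> simp [boolSign_true, boolSign_false])
    (true, true)
  exact mul_ne_zero (mul_ne_zero (boolSign_ne_zero _) (boolSign_ne_zero _)) (inv_ne_zero (hC _ _))
    hli'

lemma eq_of_finsum_eq_of_le {ι : Type*} {a b : ι → ℝ} (ha : (support a).Finite)
    (hb : (support b).Finite) (hab : ∀ i, b i ≤ a i) (h : ∑ᶠ i, b i = ∑ᶠ i, a i) (i : ι) :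
    b i = a i := by
  classical
  rw [finsum_eq_sum_of_support_subset a (s := ha.toFinset ∪ hb.toFinset) (by simp),
    finsum_eq_sum_of_support_subset b (s := ha.toFinset ∪ hb.toFinset) (by simp)] at h
  by_cases hi : i ∈ ha.toFinset ∪ hb.toFinset
  · exact (Finset.sum_eq_sum_iff_of_le fun i _ => hab i).1 h i hi
  · simp only [Finset.mem_union, Set.Finite.mem_toFinset, mem_support, not_or, not_not] at hi
    rw [hi.1, hi.2]

/-- A function given as a sum of one contribution per split, all of which are tight on every pair
of an antipodal relation. -/
lemma SplitDecomp.exists_extSet'_of_tight {d : X → X → ℝ} {ι : Type*} (D : SplitDecomp d ι)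
    {F : ι → X → ℝ} (hfin : ∀ x, (support fun i => F i x).Finite)
    (hF : ∀ i x y, D.wt i * splitDist (D.A i) x y ≤ F i x + F i y) {R : X → X → Prop}
    (hR : ∀ x, ∃ u, R x u)
    (htight : ∀ x u, R x u → ∀ i, D.wt i * splitDist (D.A i) x u = F i x + F i u) :
    ∃ f ∈ ExtSet' d, (∀ x u, R x u → f x + f u = d x u) ∧
      ∀ x y, f x + f y = d x y → ∀ i, D.wt i * splitDist (D.A i) x y = F i x + F i y := by
  have hadd : ∀ x y, (∑ᶠ i, F i x) + ∑ᶠ i, F i y = ∑ᶠ i, (F i x + F i y) := fun x y =>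
    (finsum_add_distrib (hfin x) (hfin y)).symm
  have hfin1 : ∀ x y, (support fun i => F i x + F i y).Finite := fun x y =>
    ((hfin x).union (hfin y)).subset (support_add _ _)
  have hfin2 : ∀ x y, (support fun i => D.wt i * splitDist (D.A i) x y).Finite := fun x y =>
    (D.sep_finite x y).subset fun i hi h => hi (by simp [splitDist_of_iff h])
  have hRt : ∀ x u, R x u → (∑ᶠ i, F i x) + ∑ᶠ i, F i u = d x u := by
    intro x u hxu
    rw [hadd, D.dist_eq]
    exact finsum_congr fun i => (htight x u hxu i).symm
  refine ⟨fun x => ∑ᶠ i, F i x, ⟨fun x y => ?_, fun x => ?_⟩, hRt, fun x y hxy i => ?_⟩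
  · rw [hadd, D.dist_eq]
    exact finsum_le_finsum' (hfin2 x y) (hfin1 x y) fun i => hF i x y
  · obtain ⟨u, hu⟩ := hR x
    exact ⟨u, hRt x u hu⟩
  · dsimp only at hxy
    rw [hadd, D.dist_eq] at hxy
    exact eq_of_finsum_eq_of_le (hfin1 x y) (hfin2 x y) (fun i => hF i x y) hxy.symm i

/-- An octahedral system all other splits are compatible with yields a cell that is not a
parallelotope. -/
theorem SplitDecomp.exists_not_isParallelotope {d : X → X → ℝ} {ι : Type*} (D : SplitDecomp d ι)
    (hne : ∀ i j, i ≠ j → D.A i ≠ D.A j ∧ D.A i ≠ (D.A j)ᶜ) {Y : Fin 3 → Bool → Set X}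
    (hY : OctPartition Y) {q : Bool → Bool → ι} (hq : ∀ b c, D.A (q b c) = octPart Y b c)
    (hcompat : ∀ i, (∀ b c, q b c ≠ i) → ∃ b c, CompatSplits (D.A i) (octPart Y b c)) :
    ∃ f ∈ ExtSet' d, ¬ IsParallelotope (cellOf d f) := by
  classical
  obtain ⟨κ, hκs, hκ⟩ := hY.exists_index
  have hH : ∀ i, ∃ (H : Set X) (σ : Fin 3 → Bool), (H = D.A i ∨ H = (D.A i)ᶜ) ∧
      ((∀ b c, q b c ≠ i) → H ⊆ octFace κ σ) := by
    intro i
    by_cases hi : ∀ b c, q b c ≠ i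
    · obtain ⟨b, c, h⟩ := hcompat i hi
      rw [octPart_eq_octFace hκ] at h
      unfold CompatSplits at h
      rcases h with h | h | h | h
      · exact ⟨_, _, Or.inl rfl, fun _ => h⟩
      · refine ⟨_, fun i => !(![true, b, c] i), Or.inr rfl, fun _ => ?_⟩
        rw [← octFace_compl]
        exact Set.compl_subset_compl.2 h
      · rw [octFace_compl] at h
        exact ⟨_, _, Or.inl rfl, fun _ => h⟩
      · exact ⟨_, _, Or.inr rfl, fun _ => Set.compl_subset_comm.1 h⟩
    · exact ⟨_, fun _ => true, Or.inl rfl, fun h => absurd h hi⟩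
  choose H σ hHA hHσ using hH
  have hHsep : ∀ i x y, (x ∈ H i ↔ y ∈ H i) ↔ (x ∈ D.A i ↔ y ∈ D.A i) := by
    intro i x y
    rcases hHA i with h | h <;> rw [h]
    exact not_iff_not
  have hHne : ∀ i, (∀ b c, q b c ≠ i) → H i ≠ octFace κ (σ i) := by
    intro i hi h
    obtain ⟨b, c, hbc⟩ := octFace_eq hκ (σ i)
    rw [← h, ← hq] at hbc
    obtain ⟨h1, h2⟩ := hne i (q b c) (hi b c).symm
    rcases hHA i with h' | h' <;> rw [h'] at hbc <;> rcases hbc with hbc | hbc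
    · exact h1 hbc
    · exact h2 hbc
    · exact h2 (compl_eq_comm.1 hbc).symm
    · exact h1 (compl_injective hbc)
  let R : X → X → Prop := fun x u => κ u = ((κ x).1, !(κ x).2)
  have hR : ∀ x, ∃ u, R x u := fun x => hκs _
  have hRface : ∀ x u, R x u → ∀ τ, u ∈ octFace κ τ ↔ x ∉ octFace κ τ := by
    intro x u hxu τ
    rw [mem_octFace hxu, mem_octFace (y := x) (i := (κ x).1) (b := (κ x).2) rfl]
    cases (κ x).2 <;> cases τ (κ x).1 <;> simp
  let F : ι → X → ℝ := fun i x =>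
    if ∃ b c, q b c = i then D.wt i / 2 else if x ∈ H i then D.wt i else 0
  have hFQ : ∀ i x, (∃ b c, q b c = i) → F i x = D.wt i / 2 := fun i x h => if_pos h
  have hFnQ : ∀ i x, (¬ ∃ b c, q b c = i) → F i x = if x ∈ H i then D.wt i else 0 :=
    fun i x h => if_neg h
  have hsplit : ∀ i, (¬ ∃ b c, q b c = i) → ∀ b c, q b c ≠ i := fun i h b c h' => h ⟨b, c, h'⟩
  have hnotboth : ∀ i, (¬ ∃ b c, q b c = i) → ∀ x u, R x u → x ∈ H i → u ∉ H i := by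
    intro i hi x u hxu hx hu
    exact (hRface x u hxu (σ i)).1 (hHσ i (hsplit i hi) hu) (hHσ i (hsplit i hi) hx)
  have hQfin : {i | ∃ b c, q b c = i}.Finite := by
    refine (Set.finite_range fun p : Bool × Bool => q p.1 p.2).subset ?_
    rintro i ⟨b, c, rfl⟩
    exact ⟨(b, c), rfl⟩
  obtain ⟨f, hf, hfR, hft⟩ := D.exists_extSet'_of_tight (F := F) (R := R) (fun x => by
      obtain ⟨u, hu⟩ := hR x
      refine (hQfin.union (D.sep_finite x u)).subset fun i hi => ?_
      by_cases hiQ : ∃ b c, q b c = i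
      · exact Or.inl hiQ
      · right
        have hx : x ∈ H i := by
          by_contra hx
          refine hi ?_
          simp only [hFnQ i x hiQ, if_neg hx]
        intro h
        rw [← hHsep] at h
        exact hnotboth i hiQ x u hu hx (h.1 hx)) (fun i x y => by
      have hw := D.wt_pos i
      by_cases hiQ : ∃ b c, q b c = i
      · rw [hFQ i x hiQ, hFQ i y hiQ]
        by_cases h : x ∈ D.A i ↔ y ∈ D.A i
        · rw [splitDist_of_iff h]
          linarith
        · rw [splitDist_of_not_iff h]
          linarith
      · rw [hFnQ i x hiQ, hFnQ i y hiQ]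
        by_cases h : x ∈ D.A i ↔ y ∈ D.A i
        · rw [splitDist_of_iff h]
          split_ifs <;> linarith
        · rw [splitDist_of_not_iff h]
          rw [← hHsep] at h
          split_ifs <;> first | linarith | tauto) hR fun x u hxu i => by
      by_cases hiQ : ∃ b c, q b c = i
      · rw [hFQ i x hiQ, hFQ i u hiQ, splitDist_of_not_iff]
        · ring
        · obtain ⟨b, c, rfl⟩ := hiQ
          rw [hq, octPart_eq_octFace hκ, hRface x u hxu]
          tauto
      · rw [hFnQ i x hiQ, hFnQ i u hiQ]
        have h1 := hnotboth i hiQ x u hxu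
        by_cases h : x ∈ D.A i ↔ u ∈ D.A i
        · rw [splitDist_of_iff h]
          rw [← hHsep] at h
          split_ifs <;> first | tauto | simp
        · rw [splitDist_of_not_iff h]
          rw [← hHsep] at h
          split_ifs <;> first | tauto | simp
  have hcross : ∀ i, i ∈ hQfin.toFinset ↔ Crosses d f (D.A i) := by
    intro i
    rw [Set.Finite.mem_toFinset, Set.mem_ofPred_eq]
    refine ⟨fun hiQ x y hxy h => ?_, fun hc => ?_⟩
    · have h1 := hft x y hxy i
      rw [splitDist_of_iff h, hFQ i x hiQ, hFQ i y hiQ] at h1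
      have hw := D.wt_pos i
      linarith
    · by_contra hiQ
      obtain ⟨x, hx, hxH⟩ : ∃ x ∈ octFace κ (σ i), x ∉ H i := by
        by_contra! h
        exact hHne i (hsplit i hiQ) (Set.Subset.antisymm (hHσ i (hsplit i hiQ)) h)
      obtain ⟨u, hu⟩ := hR x
      have huH : u ∉ H i := fun h => (hRface x u hu (σ i)).1 (hHσ i (hsplit i hiQ) h) hx
      refine hc x u (hfR x u hu) ?_
      rw [← hHsep]
      exact iff_of_false hxH huH
  obtain ⟨z, hz⟩ := D.cellOf_eq_zonotope hf hQfin.toFinset hcross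
  refine ⟨f, hf, ?_⟩
  rw [hz]
  exact not_isParallelotope_of_octPartition hY (fun i => by simp) hq D.wt_pos

lemma isParallelotope_of_isEmpty [IsEmpty X] {d : X → X → ℝ} (f : X → ℝ) :
    IsParallelotope (cellOf d f) := by
  refine ⟨0, fun i => i.elim0, f, linearIndependent_empty_type, ?_⟩
  ext g
  simp only [Subsingleton.elim g f]
  refine iff_of_true ⟨fun x => isEmptyElim x, fun x => isEmptyElim x⟩ ⟨fun _ => 0, ?_, ?_⟩
  · exact fun i => i.elim0
  · simp

theorem statement0 (d : X → X → ℝ) (hmet : IsMetric d)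
    (hint : IsIntegerValued d) (hTSD : TSD d) (hlrc : LRC d) :
    (¬ ∃ Y : Fin 3 → Bool → Set X, OctPartition Y ∧
        (∀ b c : Bool, IsDSplit d (octPart Y b c) (octPart Y b c)ᶜ) ∧
        (∀ A : Set X, IsDSplit d A Aᶜ →
          (∀ b c : Bool, A ≠ octPart Y b c ∧ A ≠ (octPart Y b c)ᶜ) →
          ∃ b c : Bool, CompatSplits A (octPart Y b c))) ↔
      (∀ f ∈ ExtSet d, IsParallelotope (cellOf d f)) := by
  have hsymm := hmet.1.2.1
  have hne : ∀ x₀ (i j : BaseSplit d x₀), i ≠ j → i.1 ≠ j.1 ∧ i.1 ≠ (j.1)ᶜ := fun x₀ i j hij =>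
    ⟨fun h => hij (Subtype.ext h), i.ne_compl j⟩
  constructor
  · intro hno f hf
    rcases isEmpty_or_nonempty X with hX | hX
    · exact isParallelotope_of_isEmpty f
    · obtain ⟨x₀⟩ := id hX
      have hf' := mem_extSet'_of_mem_extSet hmet.1.1 hsymm hint hlrc hf
      obtain ⟨ε, hε, N, hN⟩ := hlrc f hf
      refine (hTSD.splitDecomp hmet x₀).isParallelotope_cellOf (hne x₀) hf' (fun Y hY h => ?_)
        (hN f hf' fun x => by simpa using hε)
      have hd : ∀ b c, IsDSplit d (octPart Y b c) (octPart Y b c)ᶜ := by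
        intro b c
        obtain ⟨i, hi | hi⟩ := h b c <;> rw [hi]
        · exact i.2.1
        · exact i.2.1.compl hsymm
      exact hno ⟨Y, hY, hd, fun A hA _ => hY.exists_compatSplits hsymm hd hA⟩
  · rintro hpar ⟨Y, hY, hd, hcompat⟩
    obtain ⟨x₀, hx₀⟩ := hY.1 0 true
    have hmem : ∀ b c, x₀ ∈ octPart Y b c := fun b c => Or.inl (Or.inl hx₀)
    obtain ⟨f, hf, hnot⟩ := (hTSD.splitDecomp hmet x₀).exists_not_isParallelotope (hne x₀) hY
      (q := fun b c => ⟨octPart Y b c, hd b c, hmem b c⟩) (fun _ _ => rfl)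
      fun i hi => hcompat i.1 i.2.1 fun b c =>
        ⟨fun h => hi b c (Subtype.ext h.symm), fun h => by
          have := i.2.2
          rw [h] at this
          exact this (hmem b c)⟩
    exact hnot (hpar f (mem_extSet_of_mem_extSet' hf))
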